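/- arXiv:1404.6035 — 5 statements merged into one kernel-verified Lean document; each statement's English description precedes it below -/
import Mathlib

section
/- For every sequence (M_p)_{p≥1} of positive real numbers tending to infinity, there exists an analytic map φ : 𝔻 → 𝔻 with ∫_𝔻 |φ′(z)|² dA(z) < ∞ such that: (1) there is a constant C with ‖φ^p‖_𝒟 ≤ C·M_p for every integer p ≥ 1; and (2) φ is not a symbol, i.e. there is NO constant K such that ‖f∘φ‖_𝒟 ≤ K‖f‖_𝒟 for every analytic f : 𝔻 → ℂ with ‖f‖_𝒟 < ∞. -/
open MeasureTheory Set Metric Complex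
open scoped ENNReal NNReal

/-- The normalized area measure `dA = dx dy / π` on `ℂ`. -/
noncomputable def areaA : Measure ℂ := (ENNReal.ofReal (1 / Real.pi)) • volume

/-- The squared Dirichlet norm `‖f‖_𝒟² = |f(0)|² + ∫_𝔻 |f′|² dA`, as an extended real. -/
noncomputable def dirNorm2 (f : ℂ → ℂ) : ℝ≥0∞ :=
  ENNReal.ofReal (‖f 0‖ ^ 2) +
    ∫⁻ z in Metric.ball (0 : ℂ) 1, ENNReal.ofReal (‖deriv f z‖ ^ 2) ∂areaA

/-- The Dirichlet norm `‖f‖_𝒟`, as an extended real; `f ∈ 𝒟` iff `dirNorm f < ⊤`. -/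
noncomputable def dirNorm (f : ℂ → ℂ) : ℝ≥0∞ := dirNorm2 f ^ (1 / 2 : ℝ)

/-- The kernel `μ / (r (μ + r)²)`; it is invariant under planar rescaling. -/
noncomputable def scaleKernel (μ r : ℝ) : ℝ := μ / (r * (μ + r) ^ 2)

lemma scaleKernel_nonneg {μ r : ℝ} (hμ : 0 < μ) (hr : 0 ≤ r) : 0 ≤ scaleKernel μ r := by
  unfold scaleKernel; positivity

lemma measurable_scaleKernel (μ : ℝ) :
    Measurable fun s : ℂ => ENNReal.ofReal (scaleKernel μ ‖s‖) := by
  unfold scaleKernel; fun_prop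

lemma lintegral_scaleKernel {μ : ℝ} (hμ : 0 < μ) :
    ∫⁻ s : ℂ, ENNReal.ofReal (scaleKernel μ ‖s‖) =
      ∫⁻ s : ℂ, ENNReal.ofReal (scaleKernel 1 ‖s‖) := by
  have h := Measure.map_addHaar_smul (volume : Measure ℂ) hμ.ne'
  have h2 : ∫⁻ s : ℂ, ENNReal.ofReal (scaleKernel μ ‖s‖) ∂(Measure.map (μ • ·) volume)
      = ∫⁻ s : ℂ, ENNReal.ofReal (scaleKernel μ ‖μ • s‖) :=
    lintegral_map (measurable_scaleKernel μ) (by fun_prop)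
  have h3 : ∀ s : ℂ, scaleKernel μ ‖μ • s‖ = (μ ^ 2)⁻¹ * scaleKernel 1 ‖s‖ := by
    intro s
    rw [norm_smul, Real.norm_of_nonneg hμ.le]
    unfold scaleKernel
    rcases eq_or_ne ‖s‖ 0 with h0 | h0
    · simp [h0]
    have : 0 < 1 + ‖s‖ := by positivity
    field_simp
  rw [h, lintegral_smul_measure] at h2
  simp only [Complex.finrank_real_complex, h3] at h2
  have hp : 0 < (μ ^ 2)⁻¹ := by positivity
  simp only [ENNReal.ofReal_mul hp.le] at h2
  rw [lintegral_const_mul _ (measurable_scaleKernel 1), abs_of_pos hp, smul_eq_mul] at h2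
  exact (ENNReal.mul_right_inj (by simpa using hμ.ne') ENNReal.ofReal_ne_top).1 h2

/-- The common value of the integrals of the kernels `scaleKernel μ`. -/
noncomputable def kernelMass : ℝ := (∫⁻ s : ℂ, ENNReal.ofReal (scaleKernel 1 ‖s‖)).toReal

lemma lintegral_scaleKernel_eq {μ : ℝ} (hμ : 0 < μ) :
    ∫⁻ s : ℂ, ENNReal.ofReal (scaleKernel μ ‖s‖) = ENNReal.ofReal kernelMass := by
  rw [lintegral_scaleKernel hμ, kernelMass, ENNReal.ofReal_toReal]
  have hbnd : Integrable fun s : ℂ => scaleKernel 1 ‖s‖ := by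
    rw [integrable_fun_norm_addHaar volume (f := fun r => scaleKernel 1 r)]
    have h1 : IntegrableOn (fun r : ℝ => (1 + r ^ 2)⁻¹) (Ioi 0) :=
      integrable_inv_one_add_sq.integrableOn
    refine Integrable.mono' h1 ?_ ?_
    · apply Measurable.aestronglyMeasurable
      unfold scaleKernel
      fun_prop
    · filter_upwards [ae_restrict_mem measurableSet_Ioi] with r hr
      have hr : 0 < r := hr
      simp only [Complex.finrank_real_complex, scaleKernel, smul_eq_mul]
      rw [Real.norm_of_nonneg (by positivity)]
      have : r ^ (2 - 1) * (1 / (r * (1 + r) ^ 2)) = ((1 + r) ^ 2)⁻¹ := by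
        rw [show 2 - 1 = 1 from rfl, pow_one]
        field_simp
      rw [this]
      apply inv_anti₀ (by positivity)
      nlinarith
  have := hbnd.hasFiniteIntegral
  unfold HasFiniteIntegral at this
  convert this.ne using 4 with s
  rw [← ofReal_norm, Real.norm_of_nonneg (scaleKernel_nonneg one_pos (norm_nonneg s))]

lemma kernelMass_nonneg : 0 ≤ kernelMass := ENNReal.toReal_nonneg

/-- The half-plane kernel `l² / (l² + r²)²` is dominated by `scaleKernel l`. -/
lemma sq_div_le_scaleKernel {l r : ℝ} (hl : 0 < l) (hr : 0 < r) :
    l ^ 2 / (l ^ 2 + r ^ 2) ^ 2 ≤ scaleKernel l r := by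
  unfold scaleKernel
  rw [div_le_div_iff₀ (by positivity) (by positivity)]
  have h1 : (l + r) ^ 2 ≤ 2 * (l ^ 2 + r ^ 2) := by nlinarith [sq_nonneg (l - r)]
  have h2 : 2 * (l * r) ≤ l ^ 2 + r ^ 2 := by nlinarith [sq_nonneg (l - r)]
  have h3 : (l * r) * (l + r) ^ 2 ≤ (l ^ 2 + r ^ 2) ^ 2 := by
    calc (l * r) * (l + r) ^ 2 ≤ (l * r) * (2 * (l ^ 2 + r ^ 2)) := by gcongr
      _ = 2 * (l * r) * (l ^ 2 + r ^ 2) := by ring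
      _ ≤ (l ^ 2 + r ^ 2) * (l ^ 2 + r ^ 2) := by gcongr
      _ = _ := by ring
  calc l ^ 2 * (r * (l + r) ^ 2) = l * ((l * r) * (l + r) ^ 2) := by ring
    _ ≤ l * (l ^ 2 + r ^ 2) ^ 2 := by gcongr

lemma mul_sq_div_le_scaleKernel {l r : ℝ} (hl : 0 < l) (hr : 0 < r) :
    r * (l ^ 2 / (l ^ 2 + r ^ 2) ^ 2) ≤ 2 * l * scaleKernel l r := by
  unfold scaleKernel
  rw [← mul_div_assoc, ← mul_div_assoc, div_le_div_iff₀ (by positivity) (by positivity)]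
  have h1 : (l + r) ^ 2 ≤ 2 * (l ^ 2 + r ^ 2) := by nlinarith [sq_nonneg (l - r)]
  have h2 : r ^ 2 ≤ l ^ 2 + r ^ 2 := by nlinarith
  calc r * l ^ 2 * (r * (l + r) ^ 2) = l ^ 2 * (r ^ 2 * (l + r) ^ 2) := by ring
    _ ≤ l ^ 2 * ((l ^ 2 + r ^ 2) * (2 * (l ^ 2 + r ^ 2))) := by gcongr
    _ = _ := by ring

/-- Square of the distance to the reflected point, in the right half-plane. -/
lemma sq_add_sq_le_norm_add_sq {l : ℝ} (hl : 0 < l) {s : ℂ} (hs : 0 ≤ s.re) :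
    l ^ 2 + ‖s‖ ^ 2 ≤ ‖(l : ℂ) + s‖ ^ 2 := by
  rw [← normSq_eq_norm_sq, ← normSq_eq_norm_sq, normSq_apply, normSq_apply]
  simp
  nlinarith [mul_nonneg hl.le hs]

lemma pow_four_weight {t : ℝ} (ht : 0 ≤ t) :
    Real.exp (-(t / 16)) * (1 + t ^ 2) ^ 2 ≤ 4 * 16 ^ 4 * 24 := by
  have h := Real.pow_div_factorial_le_exp (t / 16) (by positivity) 4
  have h1 := Real.one_le_exp (x := t / 16) (by positivity)
  have hf : ((4 : ℕ).factorial : ℝ) = 24 := by norm_num [Nat.factorial]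
  rw [hf] at h
  rw [Real.exp_neg, inv_mul_le_iff₀ (Real.exp_pos _)]
  have : (1 + t ^ 2) ^ 2 ≤ 2 + 2 * t ^ 4 := by nlinarith [sq_nonneg (1 - t ^ 2)]
  have h4 : t ^ 4 = 16 ^ 4 * 24 * ((t / 16) ^ 4 / 24) := by ring
  nlinarith

/-- Amplitudes of the oscillating terms. -/
noncomputable def amp (k : ℕ) : ℝ := (1 / 16) * (1 / 2) ^ k

/-- Frequencies of the oscillating terms. -/
def freq (k : ℕ) : ℕ := 8 ^ k

lemma amp_pos (k : ℕ) : 0 < amp k := by unfold amp; positivity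

lemma hasSum_amp : HasSum amp (1 / 8) := by
  have := hasSum_geometric_two.mul_left (1 / 16 : ℝ)
  rwa [show (1 / 16 : ℝ) * 2 = 1 / 8 by norm_num] at this

lemma freq_pos (k : ℕ) : 0 < freq k := by unfold freq; positivity

/-- The Cayley-type map of the right half-plane onto the disc, sending `l` to `0`. -/
noncomputable def cayley (l : ℝ) (s : ℂ) : ℂ := (l - s) / (l + s)

lemma add_ne_zero_of_re_nonneg {l : ℝ} (hl : 0 < l) {s : ℂ} (hs : 0 ≤ s.re) :
    (l : ℂ) + s ≠ 0 := by
  intro h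
  have := congrArg Complex.re h
  simp at this
  linarith

lemma norm_cayley_sq {l : ℝ} (hl : 0 < l) {s : ℂ} (hs : 0 ≤ s.re) :
    ‖cayley l s‖ ^ 2 = 1 - 4 * l * s.re / ‖(l : ℂ) + s‖ ^ 2 := by
  have h0 := add_ne_zero_of_re_nonneg hl hs
  have h1 : ‖(l : ℂ) + s‖ ^ 2 ≠ 0 := by simpa using h0
  rw [cayley, norm_div, div_pow, eq_sub_iff_add_eq, ← add_div, div_eq_one_iff_eq h1,
    ← normSq_eq_norm_sq, ← normSq_eq_norm_sq, normSq_apply, normSq_apply]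
  simp
  ring

lemma norm_cayley_le {l : ℝ} (hl : 0 < l) {s : ℂ} (hs : 0 ≤ s.re) : ‖cayley l s‖ ≤ 1 := by
  have h := norm_cayley_sq hl hs
  have : 0 ≤ 4 * l * s.re / ‖(l : ℂ) + s‖ ^ 2 := by positivity
  nlinarith [norm_nonneg (cayley l s)]

/-- A single oscillating term. -/
noncomputable def oscTerm (l : ℕ → ℝ) (k : ℕ) (s : ℂ) : ℂ := amp k * cayley (l k) s ^ freq k

/-- The sum of all oscillating terms. -/
noncomputable def osc (l : ℕ → ℝ) (s : ℂ) : ℂ := ∑' k, oscTerm l k s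

lemma hasDerivAt_oscTerm {l : ℕ → ℝ} (hl : ∀ k, 0 < l k) (k : ℕ) {s : ℂ} (hs : 0 ≤ s.re) :
    HasDerivAt (oscTerm l k)
      (amp k * (freq k * cayley (l k) s ^ (freq k - 1) * (-(2 * l k) / (l k + s) ^ 2))) s := by
  have h0 := add_ne_zero_of_re_nonneg (hl k) hs
  have h1 : HasDerivAt (cayley (l k)) (-(2 * l k) / (l k + s) ^ 2) s := by
    have := ((hasDerivAt_id s).const_sub (l k : ℂ)).div ((hasDerivAt_id s).const_add (l k : ℂ)) h0
    convert! this using 1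
    congr 1
    simp
    ring
  exact (h1.pow (freq k)).const_mul _

lemma norm_oscTerm_le {l : ℕ → ℝ} (hl : ∀ k, 0 < l k) (k : ℕ) {s : ℂ} (hs : 0 ≤ s.re) :
    ‖oscTerm l k s‖ ≤ amp k := by
  rw [oscTerm, norm_mul, norm_pow, norm_real, Real.norm_of_nonneg (amp_pos k).le]
  exact mul_le_of_le_one_right (amp_pos k).le
    (pow_le_one₀ (norm_nonneg _) (norm_cayley_le (hl k) hs))

/-- Bound for the derivative of the oscillating power, without its amplitude. -/
noncomputable def oscSlope (l : ℕ → ℝ) (k : ℕ) (r : ℝ) : ℝ := freq k * (2 * l k / (l k ^ 2 + r ^ 2))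

lemma oscSlope_nonneg {l : ℕ → ℝ} (hl : ∀ k, 0 < l k) (k : ℕ) (r : ℝ) : 0 ≤ oscSlope l k r := by
  have := hl k
  unfold oscSlope; positivity

lemma norm_deriv_oscTerm_le {l : ℕ → ℝ} (hl : ∀ k, 0 < l k) (k : ℕ) {s : ℂ} (hs : 0 ≤ s.re) :
    ‖deriv (oscTerm l k) s‖ ≤ amp k * oscSlope l k ‖s‖ := by
  have hlk := hl k
  rw [(hasDerivAt_oscTerm hl k hs).deriv, norm_mul, norm_real, Real.norm_of_nonneg (amp_pos k).le,
    norm_mul, norm_mul, Complex.norm_natCast, norm_pow, norm_div, norm_neg, norm_pow]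
  have h2 : ‖(2 * l k : ℂ)‖ = 2 * l k := by simp [abs_of_pos hlk]
  rw [h2, mul_assoc (freq k : ℝ), oscSlope]
  have h3 := sq_add_sq_le_norm_add_sq hlk hs
  have h4 : ‖cayley (l k) s‖ ^ (freq k - 1) ≤ 1 :=
    pow_le_one₀ (norm_nonneg _) (norm_cayley_le hlk hs)
  have h5 : 0 < l k ^ 2 + ‖s‖ ^ 2 := by positivity
  have := (amp_pos k).le
  gcongr
  calc _ ≤ 1 * (2 * l k / ‖(l k : ℂ) + s‖ ^ 2) := by gcongr
    _ ≤ _ := by rw [one_mul]; gcongr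

lemma isOpen_re_pos : IsOpen {s : ℂ | 0 < s.re} := isOpen_lt continuous_const continuous_re

lemma differentiableOn_osc {l : ℕ → ℝ} (hl : ∀ k, 0 < l k) :
    DifferentiableOn ℂ (osc l) {s : ℂ | 0 < s.re} :=
  differentiableOn_tsum_of_summable_norm hasSum_amp.summable
    (fun k _ hs => (hasDerivAt_oscTerm hl k (le_of_lt hs)).differentiableAt.differentiableWithinAt)
    isOpen_re_pos (fun k _ hs => norm_oscTerm_le hl k (le_of_lt hs))

lemma hasSum_deriv_osc {l : ℕ → ℝ} (hl : ∀ k, 0 < l k) {s : ℂ} (hs : 0 < s.re) :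
    HasSum (fun k => deriv (oscTerm l k) s) (deriv (osc l) s) :=
  hasSum_deriv_of_summable_norm hasSum_amp.summable
    (fun k _ hs => (hasDerivAt_oscTerm hl k (le_of_lt hs)).differentiableAt.differentiableWithinAt)
    isOpen_re_pos (fun k _ hs => norm_oscTerm_le hl k (le_of_lt hs)) hs

lemma norm_osc_le {l : ℕ → ℝ} (hl : ∀ k, 0 < l k) {s : ℂ} (hs : 0 ≤ s.re) :
    ‖osc l s‖ ≤ 1 / 8 :=
  tsum_of_norm_bounded hasSum_amp (fun k => norm_oscTerm_le hl k hs)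

/-- Jensen's inequality for the square and a countable family of subprobability weights. -/
lemma sq_tsum_le_tsum_mul_sq {a b : ℕ → ℝ} (ha : ∀ k, 0 ≤ a k) (hs : Summable a)
    (hs1 : ∑' k, a k ≤ 1) (h1 : Summable fun k => a k * b k)
    (h2 : Summable fun k => a k * b k ^ 2) :
    (∑' k, a k * b k) ^ 2 ≤ ∑' k, a k * b k ^ 2 := by
  set B := ∑' k, a k * b k with hB
  have h : HasSum (fun k => a k * (b k - B) ^ 2)
      (∑' k, a k * b k ^ 2 - 2 * B * B + B ^ 2 * ∑' k, a k) := by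
    convert! (h2.hasSum.sub (h1.hasSum.mul_left (2 * B))).add (hs.hasSum.mul_left (B ^ 2)) using 1
    ext k
    ring
  have h0 := h.nonneg (fun k => mul_nonneg (ha k) (sq_nonneg _))
  nlinarith [sq_nonneg B]

lemma oscSlope_le {l : ℕ → ℝ} (hl : ∀ k, 0 < l k) (h1 : ∀ k, freq k * l k ≤ 1) (k : ℕ) {r : ℝ}
    (hr : 0 < r) : oscSlope l k r ≤ 2 / r ^ 2 := by
  have := hl k
  unfold oscSlope
  rw [← mul_div_assoc, div_le_div_iff₀ (by positivity) (by positivity)]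
  nlinarith [h1 k, sq_nonneg (l k), sq_pos_of_pos hr]

lemma summable_amp_mul_oscSlope {l : ℕ → ℝ} (hl : ∀ k, 0 < l k) (h1 : ∀ k, freq k * l k ≤ 1) {r : ℝ}
    (hr : 0 < r) : Summable fun k => amp k * oscSlope l k r :=
  Summable.of_nonneg_of_le (fun k => mul_nonneg (amp_pos k).le (oscSlope_nonneg hl k r))
    (fun k => mul_le_mul_of_nonneg_left (oscSlope_le hl h1 k hr) (amp_pos k).le)
    (hasSum_amp.summable.mul_right _)

lemma summable_amp_mul_oscSlope_sq {l : ℕ → ℝ} (hl : ∀ k, 0 < l k) (h1 : ∀ k, freq k * l k ≤ 1)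
    {r : ℝ} (hr : 0 < r) : Summable fun k => amp k * oscSlope l k r ^ 2 :=
  Summable.of_nonneg_of_le (fun k => mul_nonneg (amp_pos k).le (sq_nonneg _))
    (fun k => mul_le_mul_of_nonneg_left
      (pow_le_pow_left₀ (oscSlope_nonneg hl k r) (oscSlope_le hl h1 k hr) 2) (amp_pos k).le)
    (hasSum_amp.summable.mul_right _)

lemma norm_deriv_osc_sq_le {l : ℕ → ℝ} (hl : ∀ k, 0 < l k) (h1 : ∀ k, freq k * l k ≤ 1) {s : ℂ}
    (hs : 0 < s.re) : ‖deriv (osc l) s‖ ^ 2 ≤ ∑' k, amp k * oscSlope l k ‖s‖ ^ 2 := by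
  have hr : 0 < ‖s‖ := norm_pos_iff.2 (by rintro rfl; simp at hs)
  have hS := summable_amp_mul_oscSlope hl h1 hr
  have h : ‖deriv (osc l) s‖ ≤ ∑' k, amp k * oscSlope l k ‖s‖ := by
    rw [← (hasSum_deriv_osc hl hs).tsum_eq]
    exact tsum_of_norm_bounded hS.hasSum (fun k => norm_deriv_oscTerm_le hl k hs.le)
  refine (pow_le_pow_left₀ (norm_nonneg _) h 2).trans ?_
  exact sq_tsum_le_tsum_mul_sq (fun k => (amp_pos k).le) hasSum_amp.summable
    (by rw [hasSum_amp.tsum_eq]; norm_num) hS (summable_amp_mul_oscSlope_sq hl h1 hr)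

lemma norm_cpow_half (s : ℂ) : ‖s ^ (1 / 2 : ℂ)‖ = √‖s‖ := by
  have : (1 / 2 : ℂ) = ((1 / 2 : ℝ) : ℂ) := by norm_num
  rw [this, norm_cpow_real, Real.sqrt_eq_rpow]

lemma hasDerivAt_cpow_half {s : ℂ} (hs : 0 < s.re) :
    HasDerivAt (fun s : ℂ => s ^ (1 / 2 : ℂ)) (s ^ (1 / 2 : ℂ) / (2 * s)) s := by
  have h0 : s ≠ 0 := by rintro rfl; simp at hs
  have h := (hasDerivAt_id s).cpow_const (c := 1 / 2) (Or.inl hs)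
  convert! h using 1
  simp only [id]
  rw [cpow_sub _ _ h0, cpow_one]
  field_simp

lemma norm_le_re_cpow_half {s : ℂ} (hs : 0 < s.re) :
    ‖s ^ (1 / 2 : ℂ)‖ ≤ 3 / 2 * (s ^ (1 / 2 : ℂ)).re := by
  have h0 : s ≠ 0 := by rintro rfl; simp at hs
  set g := s ^ (1 / 2 : ℂ) with hg
  have hsq : g ^ 2 = s := by
    simp [hg]
  have hre : 0 ≤ g.re := by
    rw [hg, cpow_def_of_ne_zero h0, exp_re]
    refine mul_nonneg (Real.exp_pos _).le (Real.cos_nonneg_of_mem_Icc ?_)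
    have h := abs_arg_lt_pi_div_two_iff.2 (Or.inl hs)
    have hi : (log s * (1 / 2)).im = arg s / 2 := by
      rw [mul_im]; norm_num [log_im]; ring
    rw [hi]
    rw [abs_lt] at h
    constructor <;> linarith [h.1, h.2, Real.pi_pos]
  have h1 : 0 < g.re ^ 2 - g.im ^ 2 := by
    have := hs
    rw [← hsq, sq] at this
    simpa [sq] using this
  have h2 : ‖g‖ ^ 2 = g.re ^ 2 + g.im ^ 2 := by
    rw [← normSq_eq_norm_sq, normSq_apply]; ring
  apply le_of_sq_le_sq _ (by positivity)
  nlinarith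

/-- One minus the symbol, in the half-plane coordinate `s = 1 - z`. -/
noncomputable def cusp (l : ℕ → ℝ) (s : ℂ) : ℂ := 1 / 4 * (s ^ (1 / 2 : ℂ) * (1 + osc l s))

lemma hasDerivAt_cusp {l : ℕ → ℝ} (hl : ∀ k, 0 < l k) {s : ℂ} (hs : 0 < s.re) :
    HasDerivAt (cusp l)
      (1 / 4 * (s ^ (1 / 2 : ℂ) * ((1 + osc l s) / (2 * s) + deriv (osc l) s))) s := by
  have h := ((differentiableOn_osc hl).differentiableAt (isOpen_re_pos.mem_nhds hs)).hasDerivAt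
  have h2 := ((hasDerivAt_cpow_half hs).mul (h.const_add 1)).const_mul (1 / 4 : ℂ)
  convert! h2 using 1
  ring

lemma norm_one_add_osc_le {l : ℕ → ℝ} (hl : ∀ k, 0 < l k) {s : ℂ} (hs : 0 ≤ s.re) :
    ‖1 + osc l s‖ ≤ 9 / 8 := by
  have := norm_add_le 1 (osc l s)
  have := norm_osc_le hl hs
  norm_num at *
  linarith

lemma norm_cusp_le {l : ℕ → ℝ} (hl : ∀ k, 0 < l k) {s : ℂ} (hs : 0 < s.re) :
    ‖cusp l s‖ ≤ 9 / 32 * √‖s‖ := by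
  rw [cusp, norm_mul, norm_mul, norm_cpow_half s]
  have := norm_one_add_osc_le hl hs.le
  have h0 := Real.sqrt_nonneg ‖s‖
  norm_num
  nlinarith

lemma norm_one_sub_cusp_sq_le {l : ℕ → ℝ} (hl : ∀ k, 0 < l k) {s : ℂ} (hs : 0 < s.re)
    (hs2 : ‖s‖ ≤ 2) : ‖1 - cusp l s‖ ^ 2 ≤ 1 - √‖s‖ / 8 := by
  have h1 : ‖1 - cusp l s‖ ^ 2 = 1 - 2 * (cusp l s).re + ‖cusp l s‖ ^ 2 := by
    rw [← normSq_eq_norm_sq, ← normSq_eq_norm_sq, normSq_apply, normSq_apply]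
    simp
    ring
  set g := s ^ (1 / 2 : ℂ) with hg
  have hgn : ‖g‖ = √‖s‖ := norm_cpow_half s
  have hgr := norm_le_re_cpow_half hs
  have hF := norm_cusp_le hl hs
  have hre : (cusp l s).re = 1 / 4 * (g.re + (g * osc l s).re) := by
    have : cusp l s = ((1 / 4 : ℝ) : ℂ) * (g + g * osc l s) := by
      rw [cusp]; push_cast; ring
    rw [this, re_ofReal_mul, add_re]
  have h3 : -(√‖s‖ / 8) ≤ (g * osc l s).re := by
    have := abs_le.1 (abs_re_le_norm (g * osc l s))
    rw [norm_mul, hgn] at this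
    have h := norm_osc_le hl hs.le
    nlinarith [Real.sqrt_nonneg ‖s‖]
  have h4 : √‖s‖ ≤ 3 / 2 := by
    rw [Real.sqrt_le_left (by norm_num)]
    norm_num; linarith
  have h0 := Real.sqrt_nonneg ‖s‖
  rw [h1, hre]
  have h5 : ‖cusp l s‖ ^ 2 ≤ (9 / 32 * √‖s‖) ^ 2 := pow_le_pow_left₀ (norm_nonneg _) hF 2
  rw [← hg, hgn] at hgr
  nlinarith

lemma norm_deriv_cusp_sq_le {l : ℕ → ℝ} (hl : ∀ k, 0 < l k) {s : ℂ} (hs : 0 < s.re) :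
    ‖deriv (cusp l) s‖ ^ 2 ≤ 1 / ‖s‖ + ‖s‖ * ‖deriv (osc l) s‖ ^ 2 := by
  have hr : 0 < ‖s‖ := norm_pos_iff.2 (by rintro rfl; simp at hs)
  rw [(hasDerivAt_cusp hl hs).deriv, norm_mul, norm_mul, norm_cpow_half s, mul_pow, mul_pow,
    Real.sq_sqrt hr.le]
  have h1 : ‖(1 + osc l s) / (2 * s) + deriv (osc l) s‖ ≤ 1 / ‖s‖ + ‖deriv (osc l) s‖ := by
    refine (norm_add_le _ _).trans ?_
    gcongr
    rw [norm_div, norm_mul, div_le_div_iff₀ (by simpa using hr) hr]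
    have := norm_one_add_osc_le hl hs.le
    norm_num
    nlinarith
  have h2 : ‖(1 / 4 : ℂ)‖ = 1 / 4 := by norm_num
  set d := ‖deriv (osc l) s‖ with hd
  rw [h2]
  calc (1 / 4 : ℝ) ^ 2 * (‖s‖ * ‖(1 + osc l s) / (2 * s) + deriv (osc l) s‖ ^ 2)
      ≤ (1 / 4 : ℝ) ^ 2 * (‖s‖ * (1 / ‖s‖ + d) ^ 2) := by gcongr
    _ ≤ (1 / 4 : ℝ) ^ 2 * (‖s‖ * (2 * ((1 / ‖s‖) ^ 2 + d ^ 2))) := by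
        gcongr
        nlinarith [sq_nonneg (1 / ‖s‖ - d)]
    _ = 1 / 8 * (1 / ‖s‖ + ‖s‖ * d ^ 2) := by field_simp; ring
    _ ≤ _ := by
        have : 0 ≤ 1 / ‖s‖ + ‖s‖ * d ^ 2 := by positivity
        linarith

/-- The scales are so sparse that high frequencies are invisible for powers below `P k`. -/
structure SparseScales (P : ℕ → ℕ) (l : ℕ → ℝ) : Prop where
  pos : ∀ k, 0 < l k
  freq_mul_le : ∀ k, 64 * (freq k * l k) ≤ 1
  sq_mul_le : ∀ k, (freq k * P k : ℝ) ^ 2 * l k ≤ 1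
  lt_le : ∀ j k, j < k → freq k * l k ≤ l j

lemma exists_sparseScales (P : ℕ → ℕ) : ∃ l, SparseScales P l := by
  let B : ℕ → ℝ := fun k => 64 * (freq k * (P k + 1) : ℝ) ^ 2
  have hf : ∀ k, (1 : ℝ) ≤ freq k := fun k => by exact_mod_cast freq_pos k
  have hP : ∀ k, (0 : ℝ) ≤ P k := fun k => by positivity
  have hB : ∀ k, 64 * freq k ≤ B k := fun k => by
    have h1 : (1 : ℝ) ≤ P k + 1 := by linarith [hP k]
    have h2 : (freq k : ℝ) ≤ (freq k * (P k + 1) : ℝ) := by nlinarith [hf k]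
    have h3 : (1 : ℝ) ≤ (freq k * (P k + 1) : ℝ) := (hf k).trans h2
    simp only [B]
    nlinarith
  have hB2 : ∀ k, (freq k * P k : ℝ) ^ 2 ≤ B k := fun k => by
    have : (freq k * P k : ℝ) ^ 2 ≤ (freq k * (P k + 1) : ℝ) ^ 2 := by gcongr; linarith
    simp only [B]
    nlinarith [sq_nonneg (freq k * (P k + 1) : ℝ)]
  have hB1 : ∀ k, 1 ≤ B k := fun k => by linarith [hB k, hf k]
  let D : ℕ → ℝ := fun k => ∏ j ∈ Finset.range (k + 1), B j
  have hD1 : ∀ k, 1 ≤ D k := fun k => Finset.one_le_prod fun j _ => hB1 j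
  have hDs : ∀ k, D (k + 1) = D k * B (k + 1) := fun k => Finset.prod_range_succ _ _
  have hDmono : Monotone D := monotone_nat_of_le_succ fun k => by
    rw [hDs]; exact le_mul_of_one_le_right (by linarith [hD1 k]) (hB1 _)
  have hDB : ∀ k, B k ≤ D k := fun k => by
    cases k with
    | zero => simp [D]
    | succ k => rw [hDs]; exact le_mul_of_one_le_left (by linarith [hB1 (k + 1)]) (hD1 k)
  have hDpos : ∀ k, 0 < D k := fun k => by linarith [hD1 k]
  refine ⟨fun k => (D k)⁻¹, fun k => inv_pos.2 (hDpos k), fun k => ?_, fun k => ?_,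
    fun j k hjk => ?_⟩
  · rw [← mul_assoc, mul_inv_le_iff₀ (hDpos k), one_mul]
    exact (hB k).trans (hDB k)
  · rw [mul_inv_le_iff₀ (hDpos k), one_mul]
    exact (hB2 k).trans (hDB k)
  · obtain ⟨k, rfl⟩ := Nat.exists_eq_succ_of_ne_zero (Nat.ne_zero_of_lt hjk)
    rw [mul_inv_le_iff₀ (hDpos _), inv_mul_eq_div, le_div_iff₀ (hDpos j), Nat.succ_eq_add_one, hDs,
      mul_comm]
    have h1 : D j ≤ D k := hDmono (Nat.lt_succ_iff.1 hjk)
    have h2 : (freq (k + 1) : ℝ) ≤ B (k + 1) := by linarith [hB (k + 1), hf (k + 1)]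
    exact mul_le_mul h1 h2 (by positivity) (hDpos k).le

lemma scaleKernel_le {l r : ℝ} (hl : 0 < l) (hr : 0 < r) : scaleKernel l r ≤ l / r ^ 3 := by
  unfold scaleKernel
  have : r ^ 3 ≤ r * (l + r) ^ 2 := by nlinarith [sq_nonneg l, mul_pos hl hr]
  gcongr

lemma SparseScales.freq_mul_le_one {P : ℕ → ℕ} {l : ℕ → ℝ} (h : SparseScales P l) (k : ℕ) :
    freq k * l k ≤ 1 := by
  have := h.freq_mul_le k
  have : (0 : ℝ) ≤ freq k * l k := mul_nonneg (Nat.cast_nonneg _) (h.pos k).le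
  linarith

lemma SparseScales.le_one {P : ℕ → ℕ} {l : ℕ → ℝ} (h : SparseScales P l) (k : ℕ) : l k ≤ 1 := by
  have h1 := h.freq_mul_le_one k
  have h2 : (1 : ℝ) ≤ freq k := by exact_mod_cast freq_pos k
  nlinarith [h.pos k]

lemma weight_mul_oscSlope_sq_le {P : ℕ → ℕ} {l : ℕ → ℝ} (h : SparseScales P l) {p : ℕ} {m : ℝ}
    (hm : ∀ k, P k ≤ p → (freq k : ℝ) ≤ m) (k : ℕ) {r : ℝ} (hr : 0 < r) :
    (p : ℝ) ^ 2 / (1 + p ^ 2 * r) ^ 2 * r * oscSlope l k r ^ 2 ≤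
      8 * (1 + m ^ 2) * scaleKernel (l k) r := by
  have hl := h.pos k
  set N : ℝ := (freq k : ℝ) with hN
  have hN0 : 0 < N := by rw [hN]; exact_mod_cast freq_pos k
  have hQ := scaleKernel_nonneg hl hr.le
  set Q := scaleKernel (l k) r with hQd
  set X := l k ^ 2 / (l k ^ 2 + r ^ 2) ^ 2 with hX
  have hX0 : 0 ≤ X := by positivity
  have hX1 : X ≤ Q := sq_div_le_scaleKernel hl hr
  have hX2 : r * X ≤ 2 * l k * Q := mul_sq_div_le_scaleKernel hl hr
  have hs : oscSlope l k r ^ 2 = 4 * N ^ 2 * X := by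
    rw [oscSlope, hX]
    field_simp
    ring
  rw [hs]
  set W : ℝ := (p : ℝ) ^ 2 / (1 + p ^ 2 * r) ^ 2 with hW
  have hp2 : (0 : ℝ) ≤ p ^ 2 := by positivity
  by_cases hpk : P k ≤ p
  · have hW1 : W * r ≤ 1 := by
      rw [hW, div_mul_eq_mul_div, div_le_one (by positivity)]
      nlinarith [mul_nonneg hp2 hr.le]
    have hNm : N ^ 2 ≤ m ^ 2 := by
      have := hm k hpk
      gcongr
    calc W * r * (4 * N ^ 2 * X) ≤ 1 * (4 * m ^ 2 * Q) := by gcongr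
      _ ≤ _ := by nlinarith [mul_nonneg (sq_nonneg m) hQ]
  · have hpP : (p : ℝ) ≤ P k := by exact_mod_cast (not_le.1 hpk).le
    have hW1 : W ≤ p ^ 2 := by
      rw [hW]
      apply div_le_self hp2
      nlinarith [mul_nonneg hp2 hr.le]
    have hW0 : 0 ≤ W := by positivity
    have h3 : N ^ 2 * (p : ℝ) ^ 2 * l k ≤ 1 := by
      refine le_trans ?_ (h.sq_mul_le k)
      rw [mul_pow]
      gcongr
    calc W * r * (4 * N ^ 2 * X) = W * (4 * N ^ 2 * (r * X)) := by ring
      _ ≤ p ^ 2 * (4 * N ^ 2 * (2 * l k * Q)) := by gcongr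
      _ = 8 * (N ^ 2 * p ^ 2 * l k) * Q := by ring
      _ ≤ 8 * 1 * Q := by gcongr
      _ ≤ _ := by nlinarith [mul_nonneg (sq_nonneg m) hQ]

/-- The constant relating powers of the symbol to the polynomial weight. -/
noncomputable def weightConst : ℝ := 2 * (4 * 16 ^ 4 * 24)

lemma norm_one_sub_cusp_pow_le {l : ℕ → ℝ} (hl : ∀ k, 0 < l k) {s : ℂ} (hs : 0 < s.re)
    (hs2 : ‖s‖ ≤ 2) {p : ℕ} (hp : 1 ≤ p) :
    (‖1 - cusp l s‖ ^ (p - 1)) ^ 2 ≤ weightConst / (1 + p ^ 2 * ‖s‖) ^ 2 := by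
  have h1 := norm_one_sub_cusp_sq_le hl hs hs2
  have h0 := Real.sqrt_nonneg ‖s‖
  have h4 : √‖s‖ ≤ 3 / 2 := by
    rw [Real.sqrt_le_left (by norm_num)]
    norm_num; linarith
  have h2 : 1 - √‖s‖ / 8 ≤ Real.exp (-(√‖s‖ / 8)) := Real.one_sub_le_exp_neg _
  have hp1 : (1 : ℝ) ≤ p := by exact_mod_cast hp
  rw [← pow_mul, mul_comm, pow_mul, le_div_iff₀ (by positivity)]
  have h5 : (‖1 - cusp l s‖ ^ 2) ^ (p - 1) ≤ 2 * Real.exp (-(p * √‖s‖ / 16)) := by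
    calc (‖1 - cusp l s‖ ^ 2) ^ (p - 1) ≤ Real.exp (-(√‖s‖ / 8)) ^ (p - 1) := by
          gcongr
          exact h1.trans h2
      _ = Real.exp (√‖s‖ / 8) * Real.exp (-(p * √‖s‖ / 8)) := by
          rw [← Real.exp_nat_mul, ← Real.exp_add, Nat.cast_sub hp]
          congr 1
          push_cast
          ring
      _ ≤ 2 * Real.exp (-(p * √‖s‖ / 16)) := by
          gcongr ?_ * Real.exp ?_
          · have h6 : Real.exp (√‖s‖ / 8) ≤ Real.exp (1 / 2) :=
              Real.exp_le_exp.2 (by linarith)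
            have h7 : Real.exp (1 / 2) ^ 2 = Real.exp 1 := by
              rw [← Real.exp_nat_mul]; norm_num
            have h8 := Real.exp_one_lt_d9
            nlinarith [Real.exp_pos (1 / 2)]
          · nlinarith
  have h6 := pow_four_weight (t := p * √‖s‖) (by positivity)
  rw [mul_pow, Real.sq_sqrt (norm_nonneg s)] at h6
  unfold weightConst
  calc _ ≤ 2 * Real.exp (-(p * √‖s‖ / 16)) * (1 + p ^ 2 * ‖s‖) ^ 2 := by gcongr
    _ = 2 * (Real.exp (-(p * √‖s‖ / 16)) * (1 + p ^ 2 * ‖s‖) ^ 2) := by ring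
    _ ≤ _ := by gcongr

lemma norm_pow_deriv_cusp_sq_le {P : ℕ → ℕ} {l : ℕ → ℝ} (h : SparseScales P l) {p : ℕ}
    (hp : 1 ≤ p) {m : ℝ} (hm : ∀ k, P k ≤ p → (freq k : ℝ) ≤ m) {s : ℂ} (hs : 0 < s.re)
    (hs2 : ‖s‖ ≤ 2) :
    (p * ‖1 - cusp l s‖ ^ (p - 1) * ‖deriv (cusp l) s‖) ^ 2 ≤
      weightConst * (scaleKernel (((p : ℝ) ^ 2)⁻¹) ‖s‖ +
        ∑' k, amp k * (8 * (1 + m ^ 2) * scaleKernel (l k) ‖s‖)) := by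
  have hr : 0 < ‖s‖ := norm_pos_iff.2 (by rintro rfl; simp at hs)
  have hp1 : (1 : ℝ) ≤ p := by exact_mod_cast hp
  have hw : 0 < weightConst := by unfold weightConst; norm_num
  set r := ‖s‖ with hrd
  set W : ℝ := (p : ℝ) ^ 2 / (1 + p ^ 2 * r) ^ 2 with hW
  have hW0 : 0 ≤ W := by positivity
  have hQ : W / r = scaleKernel (((p : ℝ) ^ 2)⁻¹) r := by
    rw [hW, scaleKernel]
    field_simp
  have hS2 := summable_amp_mul_oscSlope_sq h.pos h.freq_mul_le_one hr
  have hSQ : Summable fun k => amp k * (8 * (1 + m ^ 2) * scaleKernel (l k) r) := by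
    refine Summable.of_nonneg_of_le (fun k => ?_) (fun k => ?_)
      (hasSum_amp.summable.mul_right (8 * (1 + m ^ 2) * (1 / r ^ 3)))
    · have := scaleKernel_nonneg (h.pos k) hr.le
      have := (amp_pos k).le
      positivity
    · have := (amp_pos k).le
      gcongr
      exact (scaleKernel_le (h.pos k) hr).trans (by gcongr; exact h.le_one k)
  rw [mul_pow, mul_pow]
  calc (p : ℝ) ^ 2 * (‖1 - cusp l s‖ ^ (p - 1)) ^ 2 * ‖deriv (cusp l) s‖ ^ 2
      ≤ (p : ℝ) ^ 2 * (weightConst / (1 + p ^ 2 * r) ^ 2) *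
          (1 / r + r * ∑' k, amp k * oscSlope l k r ^ 2) := by
        gcongr
        · exact norm_one_sub_cusp_pow_le h.pos hs hs2 hp
        · refine (norm_deriv_cusp_sq_le h.pos hs).trans ?_
          gcongr
          exact norm_deriv_osc_sq_le h.pos h.freq_mul_le_one hs
    _ = weightConst * (W / r + ∑' k, W * r * (amp k * oscSlope l k r ^ 2)) := by
        rw [tsum_mul_left, hW]; ring
    _ ≤ _ := by
        rw [hQ]
        gcongr weightConst * (_ + ?_)
        refine Summable.tsum_le_tsum (fun k => ?_) (hS2.mul_left _) hSQ
        have := weight_mul_oscSlope_sq_le h hm k hr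
        calc W * r * (amp k * oscSlope l k r ^ 2) = amp k * (W * r * oscSlope l k r ^ 2) := by ring
          _ ≤ _ := mul_le_mul_of_nonneg_left this (amp_pos k).le

/-- The self-map of the disc built from the sequence of scales `l`. -/
noncomputable def symbolMap (l : ℕ → ℝ) (z : ℂ) : ℂ := 1 - cusp l (1 - z)

lemma re_one_sub_pos {z : ℂ} (hz : z ∈ ball (0 : ℂ) 1) : 0 < (1 - z).re := by
  have h1 := Complex.re_le_norm z
  rw [mem_ball_zero_iff] at hz
  simp
  linarith

lemma norm_one_sub_le_two {z : ℂ} (hz : z ∈ ball (0 : ℂ) 1) : ‖1 - z‖ ≤ 2 := by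
  have h1 := norm_sub_le 1 z
  rw [mem_ball_zero_iff] at hz
  simp at h1
  linarith

lemma hasDerivAt_symbolMap {l : ℕ → ℝ} (hl : ∀ k, 0 < l k) {z : ℂ} (hz : z ∈ ball (0 : ℂ) 1) :
    HasDerivAt (symbolMap l) (deriv (cusp l) (1 - z)) z := by
  have h := (hasDerivAt_cusp hl (re_one_sub_pos hz)).differentiableAt.hasDerivAt
  have h2 := (h.comp z ((hasDerivAt_id z).const_sub 1)).const_sub 1
  convert! h2 using 1
  simp

lemma norm_symbolMap_lt {l : ℕ → ℝ} (hl : ∀ k, 0 < l k) {z : ℂ} (hz : z ∈ ball (0 : ℂ) 1) :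
    ‖symbolMap l z‖ < 1 := by
  have hs := re_one_sub_pos hz
  have h1 := norm_one_sub_cusp_sq_le hl hs (norm_one_sub_le_two hz)
  have hr : 0 < ‖1 - z‖ := norm_pos_iff.2 (by intro h; simp [h] at hs)
  have := Real.sqrt_pos.2 hr
  rw [symbolMap]
  nlinarith [norm_nonneg (1 - cusp l (1 - z))]

lemma setLIntegral_areaA_le (f : ℂ → ℝ≥0∞) (s : Set ℂ) :
    ∫⁻ z in s, f z ∂areaA ≤ ∫⁻ z in s, f z := by
  rw [areaA, Measure.restrict_smul, lintegral_smul_measure]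
  refine (mul_le_mul_left ?_ _).trans (one_mul _).le
  rw [ENNReal.ofReal_le_one, div_le_one Real.pi_pos]
  linarith [Real.pi_gt_three]

lemma setLIntegral_ball_le_of_le {f : ℂ → ℝ} {g : ℂ → ℝ≥0∞}
    (h : ∀ z ∈ ball (0 : ℂ) 1, ENNReal.ofReal (f z) ≤ g (1 - z)) :
    ∫⁻ z in ball (0 : ℂ) 1, ENNReal.ofReal (f z) ∂areaA ≤ ∫⁻ s, g s := by
  calc _ ≤ ∫⁻ z in ball (0 : ℂ) 1, ENNReal.ofReal (f z) := setLIntegral_areaA_le _ _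
    _ ≤ ∫⁻ z in ball (0 : ℂ) 1, g (1 - z) := setLIntegral_mono' measurableSet_ball h
    _ ≤ ∫⁻ z, g (1 - z) := setLIntegral_le_lintegral _ _
    _ = _ := lintegral_sub_left_eq_self g 1

lemma dirichletIntegral_pow_le {P : ℕ → ℕ} {l : ℕ → ℝ} (h : SparseScales P l) {p : ℕ}
    (hp : 1 ≤ p) {m : ℝ} (hm : ∀ k, P k ≤ p → (freq k : ℝ) ≤ m) :
    ∫⁻ z in ball (0 : ℂ) 1, ENNReal.ofReal (‖deriv (fun z => symbolMap l z ^ p) z‖ ^ 2) ∂areaA ≤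
      ENNReal.ofReal (weightConst * kernelMass * (2 + m ^ 2)) := by
  have hp1 : (0 : ℝ) < p := by exact_mod_cast hp
  have hw : 0 < weightConst := by unfold weightConst; norm_num
  have hamp : ∀ k, 0 ≤ amp k * (8 * (1 + m ^ 2)) := fun k => by
    have := (amp_pos k).le
    positivity
  let g : ℂ → ℝ≥0∞ := fun s => ENNReal.ofReal weightConst *
    (ENNReal.ofReal (scaleKernel (((p : ℝ) ^ 2)⁻¹) ‖s‖) +
      ∑' k, ENNReal.ofReal (amp k * (8 * (1 + m ^ 2))) * ENNReal.ofReal (scaleKernel (l k) ‖s‖))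
  refine (setLIntegral_ball_le_of_le (g := g) fun z hz => ?_).trans ?_
  · have hs := re_one_sub_pos hz
    have hd : deriv (fun z => symbolMap l z ^ p) z =
        p * symbolMap l z ^ (p - 1) * deriv (cusp l) (1 - z) :=
      ((hasDerivAt_symbolMap h.pos hz).pow p).deriv
    rw [hd, norm_mul, norm_mul, norm_pow, Complex.norm_natCast]
    refine (ENNReal.ofReal_le_ofReal
      (norm_pow_deriv_cusp_sq_le h hp hm hs (norm_one_sub_le_two hz))).trans ?_
    rw [ENNReal.ofReal_mul hw.le]
    refine mul_le_mul_right (ENNReal.ofReal_add_le.trans (add_le_add_right ?_ _)) _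
    have hk : ∀ k, 0 ≤ scaleKernel (l k) ‖1 - z‖ :=
      fun k => scaleKernel_nonneg (h.pos k) (norm_nonneg _)
    simp_rw [← ENNReal.ofReal_mul (hamp _), ← mul_assoc]
    by_cases hS : Summable fun k => amp k * 8 * (1 + m ^ 2) * scaleKernel (l k) ‖1 - z‖
    · exact (ENNReal.ofReal_tsum_of_nonneg (fun k => mul_nonneg
        (by simpa [mul_assoc] using hamp k) (hk k)) hS).le
    · rw [tsum_eq_zero_of_not_summable hS]; simp
  · have hmeas := fun k => measurable_scaleKernel (l k)
    have hmeas' := measurable_scaleKernel (((p : ℝ) ^ 2)⁻¹)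
    simp only [g]
    rw [lintegral_const_mul _ (by fun_prop), lintegral_add_left hmeas',
      lintegral_tsum (fun k => ((hmeas k).const_mul _).aemeasurable),
      lintegral_scaleKernel_eq (by positivity)]
    simp_rw [lintegral_const_mul _ (hmeas _), lintegral_scaleKernel_eq (h.pos _)]
    rw [ENNReal.tsum_mul_right,
      ← ENNReal.ofReal_tsum_of_nonneg hamp (hasSum_amp.summable.mul_right _),
      tsum_mul_right, hasSum_amp.tsum_eq, ← ENNReal.ofReal_mul (by positivity),
      ← ENNReal.ofReal_add kernelMass_nonneg (mul_nonneg (by positivity) kernelMass_nonneg),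
      ← ENNReal.ofReal_mul hw.le]
    apply ENNReal.ofReal_le_ofReal
    apply le_of_eq
    ring

/-- A thin rectangle, in the coordinate `s = 1 - z`, where the `k`-th oscillation dominates. -/
def thinRect (l : ℝ) (N : ℕ) : Set ℂ := Icc (l / (8 * N)) (l / (4 * N)) ×ℂ Icc l (2 * l)

lemma volume_thinRect {l : ℝ} (hl : 0 < l) {N : ℕ} (hN : 0 < N) :
    volume (thinRect l N) = ENNReal.ofReal (l ^ 2 / (8 * N)) := by
  have hN' : (0 : ℝ) < N := by exact_mod_cast hN
  have h : thinRect l N = measurableEquivRealProd ⁻¹'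
      (Icc (l / (8 * N)) (l / (4 * N)) ×ˢ Icc l (2 * l)) := by
    ext z; simp [thinRect, mem_reProdIm, measurableEquivRealProd_apply, Prod.le_def]; tauto
  rw [h, volume_preserving_equiv_real_prod.measure_preimage
    (measurableSet_Icc.prod measurableSet_Icc).nullMeasurableSet, Measure.volume_eq_prod,
    Measure.prod_prod, Real.volume_Icc, Real.volume_Icc,
    ← ENNReal.ofReal_mul (sub_nonneg.2 (by gcongr; norm_num))]
  congr 1
  field_simp
  ring

lemma measurableSet_thinRect (l : ℝ) (N : ℕ) : MeasurableSet (thinRect l N) :=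
  (measurable_re measurableSet_Icc).inter (measurable_im measurableSet_Icc)

section ThinRect

variable {l : ℝ} {N : ℕ} {s : ℂ}

lemma thinRect_bounds (hl : 0 < l) (hN : 0 < N) (hs : s ∈ thinRect l N) :
    0 < s.re ∧ s.re ≤ l / 4 ∧ l ≤ ‖s‖ ∧ ‖s‖ ≤ 3 * l := by
  have hN' : (1 : ℝ) ≤ N := by exact_mod_cast hN
  obtain ⟨⟨h1, h2⟩, h3, h4⟩ := hs
  have h5 : 0 < s.re := lt_of_lt_of_le (by positivity) h1
  have h6 : l / (4 * N) ≤ l / 4 := by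
    apply div_le_div_of_nonneg_left hl.le (by norm_num); linarith
  have h7 := norm_le_abs_re_add_abs_im s
  rw [abs_of_pos h5, abs_of_pos (by linarith)] at h7
  refine ⟨h5, h2.trans h6, h3.trans ((le_abs_self _).trans (abs_im_le_norm s)), ?_⟩
  linarith

lemma one_sub_mem_ball_of_mem_thinRect (hl : 0 < l) (hN : 0 < N) (hNl : 64 * (N * l) ≤ 1)
    (hs : s ∈ thinRect l N) : 1 - s ∈ ball (0 : ℂ) 1 := by
  have hN' : (1 : ℝ) ≤ N := by exact_mod_cast hN
  have hb := thinRect_bounds hl hN hs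
  obtain ⟨⟨h1, h2⟩, h3, h4⟩ := hs
  rw [mem_ball_zero_iff]
  have h : ‖1 - s‖ ^ 2 = 1 - 2 * s.re + s.re ^ 2 + s.im ^ 2 := by
    rw [← normSq_eq_norm_sq, normSq_apply]; simp; ring
  have h5 : 8 * l ^ 2 ≤ l / (8 * N) := by
    rw [le_div_iff₀ (by positivity)]
    nlinarith
  have h6 : s.re ^ 2 ≤ l ^ 2 := by nlinarith
  have h7 : s.im ^ 2 ≤ 4 * l ^ 2 := by nlinarith
  have : 0 < l ^ 2 := by positivity
  nlinarith [norm_nonneg (1 - s)]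

lemma half_le_norm_cayley_pow (hl : 0 < l) (hN : 0 < N) (hs : s ∈ thinRect l N) :
    1 / 2 ≤ ‖cayley l s‖ ^ (N - 1) := by
  have hN' : (1 : ℝ) ≤ N := by exact_mod_cast hN
  have hb := thinRect_bounds hl hN hs
  have hq := norm_cayley_sq hl hb.1.le
  have hq1 := norm_cayley_le hl hb.1.le
  have hd := sq_add_sq_le_norm_add_sq hl hb.1.le
  have hd2 : 2 * l ^ 2 ≤ ‖(l : ℂ) + s‖ ^ 2 := by nlinarith [hb.2.2.1]
  have h2 : s.re ≤ l / (4 * N) := hs.1.2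
  have h3 : 4 * l * s.re / ‖(l : ℂ) + s‖ ^ 2 ≤ 1 / (2 * N) := by
    calc _ ≤ 4 * l * (l / (4 * N)) / (2 * l ^ 2) := by gcongr
      _ = _ := by field_simp
  have h4 : 1 + -(1 / (2 * N) : ℝ) ≤ ‖cayley l s‖ := by
    nlinarith [norm_nonneg (cayley l s)]
  have h5 : (1 / (2 * N) : ℝ) ≤ 1 := by
    rw [div_le_one (by positivity)]; linarith
  have h6 := one_add_mul_le_pow (a := -(1 / (2 * N) : ℝ)) (by linarith) N
  calc (1 / 2 : ℝ) = 1 + N * (-(1 / (2 * N) : ℝ)) := by field_simp; norm_num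
    _ ≤ (1 + -(1 / (2 * N) : ℝ)) ^ N := h6
    _ ≤ ‖cayley l s‖ ^ N := by gcongr; linarith
    _ ≤ _ := pow_le_pow_of_le_one (norm_nonneg _) hq1 (Nat.sub_le N 1)

end ThinRect

lemma le_norm_deriv_oscTerm {l : ℕ → ℝ} (hl : ∀ k, 0 < l k) (k : ℕ) {s : ℂ}
    (hs : s ∈ thinRect (l k) (freq k)) :
    amp k * freq k / (6 * l k) ≤ ‖deriv (oscTerm l k) s‖ := by
  have hlk := hl k
  have hb := thinRect_bounds hlk (freq_pos k) hs
  rw [(hasDerivAt_oscTerm hl k hb.1.le).deriv, norm_mul, norm_real,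
    Real.norm_of_nonneg (amp_pos k).le, norm_mul, norm_mul, Complex.norm_natCast, norm_pow,
    norm_div, norm_neg, norm_pow]
  have h2 : ‖(2 * l k : ℂ)‖ = 2 * l k := by simp [abs_of_pos hlk]
  have h3 : ‖(l k : ℂ) + s‖ ^ 2 ≤ 6 * l k ^ 2 := by
    rw [← normSq_eq_norm_sq, normSq_apply]
    simp
    have := hs.2.1
    have := hs.2.2
    nlinarith [hb.1, hb.2.1]
  have h4 := half_le_norm_cayley_pow hlk (freq_pos k) hs
  have h5 : 0 < ‖(l k : ℂ) + s‖ ^ 2 := by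
    have := norm_pos_iff.2 (add_ne_zero_of_re_nonneg hlk hb.1.le)
    positivity
  rw [h2]
  have := (amp_pos k).le
  calc amp k * freq k / (6 * l k) = amp k * (freq k * (1 / 2) * (2 * l k / (6 * l k ^ 2))) := by
        field_simp
    _ ≤ _ := by gcongr

lemma SparseScales.oscSlope_le_of_ne {P : ℕ → ℕ} {l : ℕ → ℝ} (h : SparseScales P l) {j k : ℕ}
    (hjk : j ≠ k) {r : ℝ} (hr : l k ≤ r) : oscSlope l j r ≤ 2 / l k := by
  have hj := h.pos j
  have hk := h.pos k
  have hf : (0 : ℝ) ≤ freq j := by positivity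
  have hr2 : l k ^ 2 ≤ r ^ 2 := by gcongr
  unfold oscSlope
  rw [← mul_div_assoc, div_le_div_iff₀ (by positivity) hk]
  rcases lt_or_gt_of_ne hjk with hlt | hlt
  · have h1 : (freq j : ℝ) * l k ≤ l j := by
      refine le_trans ?_ (h.lt_le j k hlt)
      have : freq j ≤ freq k := Nat.pow_le_pow_right (by norm_num) hlt.le
      have : (freq j : ℝ) ≤ freq k := by exact_mod_cast this
      gcongr
    nlinarith [sq_nonneg r]
  · have h1 := h.lt_le k j hlt
    nlinarith [sq_nonneg (l j)]

lemma le_norm_deriv_osc {P : ℕ → ℕ} {l : ℕ → ℝ} (h : SparseScales P l) (k : ℕ) {s : ℂ}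
    (hs : s ∈ thinRect (l k) (freq k)) :
    (amp k * freq k / 6 - 1 / 4) / l k ≤ ‖deriv (osc l) s‖ := by
  have hlk := h.pos k
  have hb := thinRect_bounds hlk (freq_pos k) hs
  have hd := le_norm_deriv_oscTerm h.pos k hs
  have hS := (hasSum_deriv_osc h.pos hb.1).update k 0
  have hB : HasSum (fun j => amp j * (2 / l k)) (1 / 8 * (2 / l k)) := hasSum_amp.mul_right _
  have h1 : ‖0 - deriv (oscTerm l k) s + deriv (osc l) s‖ ≤ 1 / 8 * (2 / l k) := by
    rw [← hS.tsum_eq]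
    refine tsum_of_norm_bounded hB fun j => ?_
    have := (amp_pos j).le
    rcases eq_or_ne j k with rfl | hjk
    · simp only [Function.update_self, norm_zero]
      positivity
    · rw [Function.update_of_ne hjk]
      refine (norm_deriv_oscTerm_le h.pos j hb.1.le).trans ?_
      gcongr
      exact h.oscSlope_le_of_ne hjk hb.2.2.1
  have h2 : ‖deriv (oscTerm l k) s‖ ≤ ‖deriv (osc l) s‖ +
      ‖0 - deriv (oscTerm l k) s + deriv (osc l) s‖ := by
    have := norm_sub_le (deriv (osc l) s) (0 - deriv (oscTerm l k) s + deriv (osc l) s)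
    rwa [show deriv (osc l) s - (0 - deriv (oscTerm l k) s + deriv (osc l) s) =
      deriv (oscTerm l k) s by ring] at this
  have h3 : (amp k * freq k / 6 - 1 / 4) / l k =
      amp k * freq k / (6 * l k) - 1 / 8 * (2 / l k) := by field_simp; ring
  rw [h3]
  linarith

lemma le_norm_deriv_cusp {P : ℕ → ℕ} {l : ℕ → ℝ} (h : SparseScales P l) (k : ℕ) {s : ℂ}
    (hs : s ∈ thinRect (l k) (freq k)) (hk : 1 ≤ amp k * freq k / 6) :
    1 / 4 * (√(l k) * ((amp k * freq k / 6 - 1) / l k)) ≤ ‖deriv (cusp l) s‖ := by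
  have hlk := h.pos k
  have hb := thinRect_bounds hlk (freq_pos k) hs
  have hr : 0 < ‖s‖ := hlk.trans_le hb.2.2.1
  rw [(hasDerivAt_cusp h.pos hb.1).deriv, norm_mul, norm_mul, norm_cpow_half s]
  have h2 : ‖(1 / 4 : ℂ)‖ = 1 / 4 := by norm_num
  have h1 : ‖(1 + osc l s) / (2 * s)‖ ≤ (9 / 16) / l k := by
    have := norm_one_add_osc_le h.pos hb.1.le
    rw [norm_div, norm_mul]
    calc _ ≤ (9 / 8) / (‖(2 : ℂ)‖ * l k) := by gcongr; exacts [mul_pos (by norm_num) hlk, hb.2.2.1]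
      _ = _ := by norm_num; field_simp; norm_num
  have h3 := le_norm_deriv_osc h k hs
  have h4 := norm_sub_le ((1 + osc l s) / (2 * s) + deriv (osc l) s) ((1 + osc l s) / (2 * s))
  rw [add_sub_cancel_left] at h4
  have h5 : (amp k * freq k / 6 - 1) / l k ≤ ‖(1 + osc l s) / (2 * s) + deriv (osc l) s‖ := by
    have e1 : (amp k * freq k / 6 - 1) / l k =
      (amp k * freq k / 6 - 1 / 4) / l k - (9 / 16) / l k - (3 / 16) / l k := by ring
    have : 0 < (3 / 16) / l k := by positivity
    linarith
  have h6 : 0 ≤ (amp k * freq k / 6 - 1) / l k := div_nonneg (by linarith) hlk.le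
  rw [h2]
  gcongr
  exact hb.2.2.1

/-- Test function concentrated near the boundary point `1` at distance `h`. -/
noncomputable def testFun (h : ℝ) (w : ℂ) : ℂ := h / (h + (1 - w))

lemma hasDerivAt_testFun {h : ℝ} (hh : 0 < h) {w : ℂ} (hw : w ∈ ball (0 : ℂ) 1) :
    HasDerivAt (testFun h) (h / (h + (1 - w)) ^ 2) w := by
  have h0 := add_ne_zero_of_re_nonneg hh (re_one_sub_pos hw).le
  have := (hasDerivAt_const w (h : ℂ)).div
    (((hasDerivAt_id w).const_sub 1).const_add (h : ℂ)) h0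
  convert! this using 1
  simp

lemma dirNorm2_testFun_le {h : ℝ} (hh : 0 < h) :
    dirNorm2 (testFun h) ≤ ENNReal.ofReal (1 + kernelMass) := by
  rw [dirNorm2, ENNReal.ofReal_add zero_le_one kernelMass_nonneg]
  refine add_le_add (ENNReal.ofReal_le_ofReal ?_) ?_
  · have : testFun h 0 = ((h / (h + 1) : ℝ) : ℂ) := by simp [testFun]
    rw [this, norm_real, Real.norm_of_nonneg (by positivity)]
    apply pow_le_one₀ (by positivity)
    rw [div_le_one (by positivity)]
    linarith
  · rw [← lintegral_scaleKernel_eq hh]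
    refine setLIntegral_ball_le_of_le (g := fun s => ENNReal.ofReal (scaleKernel h ‖s‖))
      fun z hz => ENNReal.ofReal_le_ofReal ?_
    have hs := re_one_sub_pos hz
    have hr : 0 < ‖1 - z‖ := norm_pos_iff.2 (by intro h; simp [h] at hs)
    rw [(hasDerivAt_testFun hh hz).deriv, norm_div, norm_pow, norm_real,
      Real.norm_of_nonneg hh.le, div_pow]
    refine le_trans ?_ (sq_div_le_scaleKernel hh hr)
    have := sq_add_sq_le_norm_add_sq hh hs.le
    gcongr

lemma le_norm_deriv_testFun_comp {P : ℕ → ℕ} {l : ℕ → ℝ} (h : SparseScales P l) {k : ℕ} {z : ℂ}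
    (hz : 1 - z ∈ thinRect (l k) (freq k)) (hk : 1 ≤ amp k * freq k / 6) :
    (amp k * freq k / 6 - 1) / (16 * l k) ≤ ‖deriv (testFun √(l k) ∘ symbolMap l) z‖ := by
  have hlk := h.pos k
  have hzb : z ∈ ball (0 : ℂ) 1 := by
    have := one_sub_mem_ball_of_mem_thinRect hlk (freq_pos k) (h.freq_mul_le k) hz
    rwa [sub_sub_cancel] at this
  have hb := thinRect_bounds hlk (freq_pos k) hz
  have hφ : symbolMap l z ∈ ball (0 : ℂ) 1 := mem_ball_zero_iff.2 (norm_symbolMap_lt h.pos hzb)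
  set H := √(l k) with hH
  have hH0 : 0 < H := Real.sqrt_pos.2 hlk
  rw [((hasDerivAt_testFun hH0 hφ).comp z (hasDerivAt_symbolMap h.pos hzb)).deriv, norm_mul,
    norm_div, norm_pow, norm_real, Real.norm_of_nonneg hH0.le]
  have h1 : ‖(H : ℂ) + (1 - symbolMap l z)‖ ≤ 2 * H := by
    refine (norm_add_le _ _).trans ?_
    rw [norm_real, Real.norm_of_nonneg hH0.le, symbolMap, sub_sub_cancel]
    have h2 := norm_cusp_le h.pos hb.1
    have h3 : √‖1 - z‖ ≤ 2 * H := by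
      rw [Real.sqrt_le_left (by positivity), mul_pow, hH, Real.sq_sqrt hlk.le]
      linarith [hb.2.2.2]
    linarith
  have h4 : 0 < ‖(H : ℂ) + (1 - symbolMap l z)‖ :=
    norm_pos_iff.2 (add_ne_zero_of_re_nonneg hH0 (re_one_sub_pos hφ).le)
  have h5 := le_norm_deriv_cusp h k hz hk
  have h6 : 0 ≤ (amp k * freq k / 6 - 1) / l k := div_nonneg (by linarith) hlk.le
  calc (amp k * freq k / 6 - 1) / (16 * l k)
      = H / (2 * H) ^ 2 * (1 / 4 * (H * ((amp k * freq k / 6 - 1) / l k))) := by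
        field_simp; ring
    _ ≤ _ := by gcongr

lemma le_dirNorm2_testFun_comp {P : ℕ → ℕ} {l : ℕ → ℝ} (h : SparseScales P l) {k : ℕ}
    (hk : 1 ≤ amp k * freq k / 6) :
    ENNReal.ofReal ((amp k * freq k / 6 - 1) ^ 2 / (2048 * Real.pi * freq k)) ≤
      dirNorm2 (testFun √(l k) ∘ symbolMap l) := by
  have hlk := h.pos k
  have hN : (0 : ℝ) < freq k := by exact_mod_cast freq_pos k
  set A := amp k * freq k / 6 - 1 with hA
  have hpre : volume ((fun z : ℂ => 1 - z) ⁻¹' thinRect (l k) (freq k)) =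
      ENNReal.ofReal (l k ^ 2 / (8 * freq k)) := by
    rw [(Measure.measurePreserving_sub_left volume (1 : ℂ)).measure_preimage
      (measurableSet_thinRect _ _).nullMeasurableSet, volume_thinRect hlk (freq_pos k)]
  have hmeas : MeasurableSet ((fun z : ℂ => 1 - z) ⁻¹' thinRect (l k) (freq k)) :=
    (measurable_const.sub measurable_id) (measurableSet_thinRect _ _)
  have hsub : (fun z : ℂ => 1 - z) ⁻¹' thinRect (l k) (freq k) ⊆ ball (0 : ℂ) 1 := fun z hz => by
    have := one_sub_mem_ball_of_mem_thinRect hlk (freq_pos k) (h.freq_mul_le k) hz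
    rwa [sub_sub_cancel] at this
  rw [dirNorm2]
  refine le_trans ?_ (le_add_left (lintegral_mono_set hsub))
  calc ENNReal.ofReal (A ^ 2 / (2048 * Real.pi * freq k))
      = ∫⁻ _ in (fun z : ℂ => 1 - z) ⁻¹' thinRect (l k) (freq k),
          ENNReal.ofReal ((A / (16 * l k)) ^ 2) ∂areaA := by
        have hpi := Real.pi_pos
        rw [setLIntegral_const, areaA, Measure.smul_apply, hpre, smul_eq_mul,
          ← ENNReal.ofReal_mul (by positivity), ← ENNReal.ofReal_mul (by positivity)]
        congr 1
        field_simp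
        ring
    _ ≤ _ := by
        refine setLIntegral_mono' hmeas fun z hz => ENNReal.ofReal_le_ofReal ?_
        have := le_norm_deriv_testFun_comp h hz hk
        have : 0 ≤ A / (16 * l k) := div_nonneg (by linarith) (by positivity)
        gcongr

lemma tendsto_testFun_lower_bound :
    Filter.Tendsto (fun k => (amp k * freq k / 6 - 1) ^ 2 / (2048 * Real.pi * freq k))
      Filter.atTop Filter.atTop := by
  have hpi := Real.pi_pos
  have h2 : Filter.Tendsto (fun k : ℕ => (2 : ℝ) ^ k / (192 ^ 2 * (2048 * Real.pi)))
      Filter.atTop Filter.atTop :=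
    (tendsto_pow_atTop_atTop_of_one_lt one_lt_two).atTop_div_const (by positivity)
  refine Filter.tendsto_atTop_mono' _ ?_ h2
  filter_upwards [Filter.eventually_ge_atTop 4] with k hk
  have e1 : amp k * freq k = 4 ^ k / 16 := by
    rw [amp, freq]
    push_cast
    rw [mul_assoc, ← mul_pow]
    norm_num
    ring
  have h4 : (4 : ℝ) ^ 4 ≤ 4 ^ k := pow_le_pow_right₀ (by norm_num) hk
  have e2 : (2 : ℝ) ^ k * 8 ^ k = (4 ^ k) ^ 2 := by
    rw [← mul_pow, ← pow_mul, mul_comm k 2, pow_mul]; norm_num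
  rw [e1, freq, div_le_div_iff₀ (by positivity) (by positivity)]
  push_cast
  have h5 : (4 : ℝ) ^ k / 192 ≤ 4 ^ k / 16 / 6 - 1 := by linarith
  have h6 : ((4 : ℝ) ^ k / 192) ^ 2 ≤ (4 ^ k / 16 / 6 - 1) ^ 2 := by gcongr
  calc (2 : ℝ) ^ k * (2048 * Real.pi * 8 ^ k) = (2 ^ k * 8 ^ k) * (2048 * Real.pi) := by ring
    _ = ((4 : ℝ) ^ k / 192) ^ 2 * (192 ^ 2 * (2048 * Real.pi)) := by rw [e2]; ring
    _ ≤ _ := by gcongr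

lemma eventually_one_le_amp_mul_freq : ∀ᶠ k in Filter.atTop, 1 ≤ amp k * freq k / 6 := by
  filter_upwards [Filter.eventually_ge_atTop 4] with k hk
  have e1 : amp k * freq k = 4 ^ k / 16 := by
    rw [amp, freq]
    push_cast
    rw [mul_assoc, ← mul_pow]
    norm_num
    ring
  have h4 : (4 : ℝ) ^ 4 ≤ 4 ^ k := pow_le_pow_right₀ (by norm_num) hk
  rw [e1]
  linarith

lemma dirNorm_sq (f : ℂ → ℂ) : dirNorm f ^ 2 = dirNorm2 f := by
  rw [dirNorm, ← ENNReal.rpow_natCast, ← ENNReal.rpow_mul]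
  norm_num

theorem not_bounded_comp_symbolMap {P : ℕ → ℕ} {l : ℕ → ℝ} (h : SparseScales P l) :
    ¬ ∃ K : ℝ, ∀ f : ℂ → ℂ, DifferentiableOn ℂ f (ball 0 1) → dirNorm f < ⊤ →
      dirNorm (f ∘ symbolMap l) ≤ ENNReal.ofReal K * dirNorm f := by
  rintro ⟨K, hK⟩
  obtain ⟨k, hk1, hk2⟩ := ((tendsto_testFun_lower_bound.eventually_gt_atTop
    ((max K 0) ^ 2 * (1 + kernelMass))).and eventually_one_le_amp_mul_freq).exists
  have hH : 0 < √(l k) := Real.sqrt_pos.2 (h.pos k)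
  have hM := kernelMass_nonneg
  have ht := dirNorm2_testFun_le hH
  have hfin : dirNorm (testFun √(l k)) < ⊤ := by
    rw [dirNorm]
    exact ENNReal.rpow_lt_top_of_nonneg (by norm_num) (ht.trans_lt ENNReal.ofReal_lt_top).ne
  have hc := hK _ (fun w hw =>
    (hasDerivAt_testFun hH hw).differentiableAt.differentiableWithinAt) hfin
  have hc2 := pow_le_pow_left₀ zero_le hc 2
  rw [mul_pow, dirNorm_sq, dirNorm_sq] at hc2
  have := (le_dirNorm2_testFun_comp h hk2).trans (hc2.trans (mul_le_mul_right ht _))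
  have hKK : ENNReal.ofReal K = ENNReal.ofReal (max K 0) := by
    rcases le_total K 0 with h0 | h0
    · simp [h0]
    · rw [max_eq_left h0]
  rw [hKK, ← ENNReal.ofReal_pow (le_max_right _ _), ← ENNReal.ofReal_mul (by positivity),
    ENNReal.ofReal_le_ofReal_iff (by positivity)] at this
  linarith

/-- For every sequence `(M_p)` of positive reals tending to `∞`, there is an analytic
self-map `φ` of the unit disk, with finite Dirichlet integral, such that
`‖φ^p‖_𝒟 = O(M_p)` but `φ` is not a symbol of the Dirichlet space. -/
theorem statement0 (M : ℕ → ℝ) (hMpos : ∀ p, 1 ≤ p → 0 < M p)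
    (hM : Filter.Tendsto M Filter.atTop Filter.atTop) :
    ∃ φ : ℂ → ℂ, DifferentiableOn ℂ φ (Metric.ball 0 1) ∧
      Set.MapsTo φ (Metric.ball 0 1) (Metric.ball 0 1) ∧
      (∫⁻ z in Metric.ball (0 : ℂ) 1, ENNReal.ofReal (‖deriv φ z‖ ^ 2) ∂areaA) < ⊤ ∧
      (∃ C : ℝ, ∀ p : ℕ, 1 ≤ p →
        dirNorm (fun z => φ z ^ p) ≤ ENNReal.ofReal (C * M p)) ∧
      ¬ ∃ K : ℝ, ∀ f : ℂ → ℂ, DifferentiableOn ℂ f (Metric.ball 0 1) → dirNorm f < ⊤ →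
          dirNorm (f ∘ φ) ≤ ENNReal.ofReal K * dirNorm f := by
  have hP : ∀ k, ∃ n, ∀ p, n ≤ p → (freq k : ℝ) ≤ M p := fun k =>
    Filter.eventually_atTop.1 (hM.eventually_ge_atTop (freq k : ℝ))
  choose P hP using hP
  obtain ⟨l, hl⟩ := exists_sparseScales P
  have hbnd := fun (p : ℕ) (hp : 1 ≤ p) =>
    dirichletIntegral_pow_le hl hp (m := M p) (fun k hk => hP k p hk)
  have hw : 0 < weightConst := by unfold weightConst; norm_num
  have hmass := kernelMass_nonneg
  refine ⟨symbolMap l, fun z hz =>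
    (hasDerivAt_symbolMap hl.pos hz).differentiableAt.differentiableWithinAt,
    fun z hz => mem_ball_zero_iff.2 (norm_symbolMap_lt hl.pos hz), ?_, ?_,
    not_bounded_comp_symbolMap hl⟩
  · have := hbnd 1 le_rfl
    simp only [pow_one] at this
    exact this.trans_lt ENNReal.ofReal_lt_top
  · obtain ⟨δ, hδ, hδM⟩ : ∃ δ : ℝ, 0 < δ ∧ ∀ p, 1 ≤ p → δ ≤ M p := by
      obtain ⟨n, hn⟩ := Filter.eventually_atTop.1 (hM.eventually_ge_atTop 1)
      obtain ⟨q, hq, hqmin⟩ := Finset.exists_min_image (Finset.Icc 1 (n + 1)) M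
        ⟨1, by simp⟩
      refine ⟨min 1 (M q), lt_min one_pos (hMpos q (Finset.mem_Icc.1 hq).1), fun p hp => ?_⟩
      by_cases hpn : p ≤ n + 1
      · exact (min_le_right _ _).trans (hqmin p (Finset.mem_Icc.2 ⟨hp, hpn⟩))
      · exact (min_le_left _ _).trans (hn p (by omega))
    set a := weightConst * kernelMass with ha
    have ha0 : 0 ≤ a := by positivity
    set D := (1 + 2 * a) / δ ^ 2 + a with hD
    have hD0 : 0 ≤ D := by positivity
    refine ⟨√D, fun p hp => ?_⟩
    have hMp := hMpos p hp
    rw [← ENNReal.pow_le_pow_left_iff two_ne_zero, dirNorm_sq,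
      ← ENNReal.ofReal_pow (by positivity), mul_pow, Real.sq_sqrt hD0, dirNorm2]
    have h0 : ‖symbolMap l 0 ^ p‖ ^ 2 ≤ 1 := by
      rw [norm_pow]
      exact pow_le_one₀ (by positivity) (pow_le_one₀ (norm_nonneg _)
        (norm_symbolMap_lt hl.pos (mem_ball_self one_pos)).le)
    refine (add_le_add (ENNReal.ofReal_le_ofReal h0) (hbnd p hp)).trans ?_
    rw [← ENNReal.ofReal_add zero_le_one (by positivity)]
    apply ENNReal.ofReal_le_ofReal
    have h1 : 1 ≤ M p ^ 2 / δ ^ 2 := by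
      rw [one_le_div (by positivity)]
      have := hδM p hp
      gcongr
    calc 1 + a * (2 + M p ^ 2) = (1 + 2 * a) * 1 + a * M p ^ 2 := by ring
      _ ≤ (1 + 2 * a) * (M p ^ 2 / δ ^ 2) + a * M p ^ 2 := by gcongr
      _ = D * M p ^ 2 := by rw [hD]; ring
end

section
/- Let (ε_j)_{j≥1} be a nonincreasing sequence of positive real numbers with ε_1 ≤ 2^{−8}, let δ satisfy ε_1 ≤ δ ≤ 1 − ε_1, set c_j = 1 − 2δ^j, r_j = ε_j·δ^j, Δ_j = {z ∈ ℂ : |z − c_j| < r_j}, and for i, j ≥ 1 define m_{i,j} = (1/(r_i r_j)) ∫_{Δ_j} ∫_{Δ_i} (1 − w·conj(z))^{−2} dA(z) dA(w). Then for every i ≥ 1 the diagonal entry m_{i,i} is a real number and m_{i,i} ≥ ε_i²/32. -/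
open MeasureTheory
open scoped ENNReal

/-- The entries `m_{i,j} = (1/(r_i r_j)) ∬_{Δ_i × Δ_j} (1 - w conj z)^{-2} dA(z) dA(w)`,
where `Δ_j` is the disk of center `c_j = 1 - 2δ^j` and radius `r_j = ε_j δ^j`. -/
noncomputable def mEntry (ε : ℕ → ℝ) (δ : ℝ) (i j : ℕ) : ℂ :=
  (1 / (((ε i * δ ^ i) * (ε j * δ ^ j) : ℝ) : ℂ)) *
    ∫ w in Metric.ball (((1 - 2 * δ ^ j : ℝ)) : ℂ) (ε j * δ ^ j),
      ∫ z in Metric.ball (((1 - 2 * δ ^ i : ℝ)) : ℂ) (ε i * δ ^ i),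
        ((1 - w * (starRingEnd ℂ) z) ^ 2)⁻¹ ∂areaA ∂areaA


open Metric in
/-- The **mean value property** over disks, with respect to Lebesgue measure. -/
theorem DiffContOnCl.setIntegral_ball {f : ℂ → ℂ} {c : ℂ} {R : ℝ} (hR : 0 < R)
    (hf : DiffContOnCl ℂ f (ball c R)) :
    ∫ z in ball c R, f z = (Real.pi * R ^ 2) • f c := by
  have hcont : ContinuousOn f (closedBall c R) := by
    simpa [closure_ball c hR.ne'] using hf.continuousOn
  have hpolar (p : ℝ × ℝ) : Complex.polarCoord.symm p + c = circleMap c p.1 p.2 := by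
    simp [circleMap, Complex.exp_mul_I, add_comm]
  have hmem {p : ℝ × ℝ} (hp : 0 < p.1) : circleMap c p.1 p.2 ∈ ball c R ↔ p.1 < R := by
    simp [mem_ball, dist_eq_norm, abs_of_pos hp]
  have hint : IntegrableOn (fun p : ℝ × ℝ ↦ p.1 • f (circleMap c p.1 p.2))
      (Set.Ioo 0 R ×ˢ Set.Ioo (-Real.pi) Real.pi) := by
    refine IntegrableOn.mono_set (t := Set.Icc 0 R ×ˢ Set.Icc (-Real.pi) Real.pi) ?_
      (Set.prod_mono Set.Ioo_subset_Icc_self Set.Ioo_subset_Icc_self)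
    refine ContinuousOn.integrableOn_compact (isCompact_Icc.prod isCompact_Icc) ?_
    refine continuousOn_fst.smul (hcont.comp ?_ ?_)
    · unfold circleMap
      fun_prop
    · rintro p ⟨hp, -⟩
      simpa [mem_closedBall, dist_eq_norm, abs_of_nonneg hp.1] using hp.2
  have hangle {r : ℝ} (hr : r ∈ Set.Ioo 0 R) :
      ∫ θ in Set.Ioo (-Real.pi) Real.pi, r • f (circleMap c r θ) =
        (2 * Real.pi * r) • f c := by
    have hmean : Real.circleAverage f c r = f c := by
      refine DiffContOnCl.circleAverage (hf.mono ?_)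
      rw [abs_of_pos hr.1]
      exact ball_subset_ball hr.2.le
    have hper := ((periodic_circleMap c r).comp f).intervalIntegral_add_eq (-Real.pi) 0
    rw [show -Real.pi + 2 * Real.pi = Real.pi by ring, zero_add] at hper
    rw [integral_smul, ← integral_Ioc_eq_integral_Ioo,
      ← intervalIntegral.integral_of_le (by linarith [Real.pi_pos])]
    simp only [Function.comp_def] at hper
    rw [hper, ← hmean, Real.circleAverage_def, smul_smul]
    congr 1
    field_simp
  calc ∫ z in ball c R, f z
      = ∫ z, (ball c R).indicator f (z + c) := by
        rw [integral_add_right_eq_self (fun z ↦ (ball c R).indicator f z),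
          integral_indicator measurableSet_ball]
    _ = ∫ p in polarCoord.target, p.1 • (ball c R).indicator f (circleMap c p.1 p.2) := by
        rw [← Complex.integral_comp_polarCoord_symm]
        simp_rw [hpolar]
    _ = ∫ p in polarCoord.target,
          (Set.Ioo 0 R ×ˢ Set.Ioo (-Real.pi) Real.pi).indicator
            (fun p : ℝ × ℝ ↦ p.1 • f (circleMap c p.1 p.2)) p := by
        refine setIntegral_congr_fun polarCoord.open_target.measurableSet fun p hp ↦ ?_
        have hp0 : 0 < p.1 := hp.1
        by_cases hpR : p.1 < R
        · have : p ∈ Set.Ioo 0 R ×ˢ Set.Ioo (-Real.pi) Real.pi := ⟨⟨hp0, hpR⟩, hp.2⟩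
          simp only [Set.indicator_of_mem this, Set.indicator_of_mem ((hmem hp0).2 hpR)]
        · have : p ∉ Set.Ioo 0 R ×ˢ Set.Ioo (-Real.pi) Real.pi := fun h ↦ hpR h.1.2
          simp only [Set.indicator_of_notMem this,
            Set.indicator_of_notMem (mt (hmem hp0).1 hpR), smul_zero]
    _ = ∫ p in Set.Ioo 0 R ×ˢ Set.Ioo (-Real.pi) Real.pi,
          p.1 • f (circleMap c p.1 p.2) := by
        rw [setIntegral_indicator (measurableSet_Ioo.prod measurableSet_Ioo)]
        congr 2
        exact Set.inter_eq_right.2 (Set.prod_mono Set.Ioo_subset_Ioi_self subset_rfl)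
    _ = ∫ r in Set.Ioo 0 R, (2 * Real.pi * r) • f c := by
        rw [Measure.volume_eq_prod, setIntegral_prod _ hint]
        exact setIntegral_congr_fun measurableSet_Ioo fun r hr ↦ hangle hr
    _ = (Real.pi * R ^ 2) • f c := by
        rw [integral_smul_const, ← integral_Ioc_eq_integral_Ioo,
          ← intervalIntegral.integral_of_le hR.le, intervalIntegral.integral_const_mul,
          integral_id]
        congr 1
        ring

theorem setIntegral_areaA (s : Set ℂ) (f : ℂ → ℂ) :
    ∫ z in s, f z ∂areaA = (1 / Real.pi) • ∫ z in s, f z := by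
  rw [areaA, Measure.restrict_smul, integral_smul_measure,
    ENNReal.toReal_ofReal (by positivity)]

/-- The mean value property over disks, with respect to normalized area measure. -/
theorem DiffContOnCl.setIntegral_ball_areaA {f : ℂ → ℂ} {c : ℂ} {R : ℝ} (hR : 0 < R)
    (hf : DiffContOnCl ℂ f (Metric.ball c R)) :
    ∫ z in Metric.ball c R, f z ∂areaA = (R : ℂ) ^ 2 * f c := by
  rw [setIntegral_areaA, hf.setIntegral_ball hR, smul_smul, Complex.real_smul]
  push_cast
  field_simp

theorem one_sub_mul_ne_zero {a z : ℂ} (ha : ‖a‖ < 1) (hz : ‖z‖ ≤ 1) : 1 - a * z ≠ 0 := by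
  intro h
  have h1 : ‖a * z‖ = 1 := by rw [← sub_eq_zero.1 h, norm_one]
  rw [norm_mul] at h1
  nlinarith [norm_nonneg a, norm_nonneg z]

/-- The area integral of the Bergman kernel over a disk inside the unit disk. -/
theorem setIntegral_ball_bergman {a c : ℂ} {R : ℝ} (ha : ‖a‖ < 1) (hR : 0 < R)
    (hcR : ‖c‖ + R ≤ 1) :
    ∫ z in Metric.ball c R, ((1 - a * z) ^ 2)⁻¹ ∂areaA =
      (R : ℂ) ^ 2 * ((1 - a * c) ^ 2)⁻¹ := by
  refine DiffContOnCl.setIntegral_ball_areaA (f := fun z ↦ ((1 - a * z) ^ 2)⁻¹) hR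
    (DifferentiableOn.diffContOnCl ?_)
  rw [closure_ball c hR.ne']
  refine DifferentiableOn.inv (by fun_prop) fun z hz ↦ pow_ne_zero 2 (one_sub_mul_ne_zero ha ?_)
  have h1 : ‖z - c‖ ≤ R := by simpa [dist_eq_norm] using hz
  linarith [norm_le_norm_add_norm_sub c z, norm_sub_rev z c]

theorem setIntegral_ball_bergman_conj {w c : ℂ} {R : ℝ} (hw : ‖w‖ < 1) (hR : 0 < R)
    (hcR : ‖c‖ + R ≤ 1) :
    ∫ z in Metric.ball c R, ((1 - w * (starRingEnd ℂ) z) ^ 2)⁻¹ ∂areaA =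
      (R : ℂ) ^ 2 * ((1 - w * (starRingEnd ℂ) c) ^ 2)⁻¹ := by
  have h := congrArg (starRingEnd ℂ)
    (setIntegral_ball_bergman (a := (starRingEnd ℂ) w) (by simpa using hw) hR hcR)
  rw [← integral_conj] at h
  simpa using h

/-- The diagonal entries `m_{i,i}` in closed form. -/
theorem mEntry_self {ε : ℕ → ℝ} {δ : ℝ} {i : ℕ} (hr : 0 < ε i * δ ^ i)
    (h : |1 - 2 * δ ^ i| + ε i * δ ^ i ≤ 1) :
    mEntry ε δ i i =
      (((ε i * δ ^ i) ^ 2 / (1 - (1 - 2 * δ ^ i) ^ 2) ^ 2 : ℝ) : ℂ) := by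
  unfold mEntry
  generalize ε i * δ ^ i = r at *
  generalize 1 - 2 * δ ^ i = c at *
  have hc : ‖(c : ℂ)‖ + r ≤ 1 := by simpa using h
  have hinner : ∀ w ∈ Metric.ball (c : ℂ) r,
      ∫ z in Metric.ball (c : ℂ) r, ((1 - w * (starRingEnd ℂ) z) ^ 2)⁻¹ ∂areaA =
        (r : ℂ) ^ 2 * ((1 - c * w) ^ 2)⁻¹ := by
    intro w hw
    rw [mem_ball_iff_norm] at hw
    rw [setIntegral_ball_bergman_conj _ hr hc, Complex.conj_ofReal, mul_comm w]
    linarith [norm_le_norm_add_norm_sub (c : ℂ) w, norm_sub_rev w (c : ℂ)]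
  rw [setIntegral_congr_fun measurableSet_ball hinner, integral_const_mul,
    setIntegral_ball_bergman (by linarith) hr hc]
  have hr' : (r : ℂ) ≠ 0 := by exact_mod_cast hr.ne'
  push_cast
  field_simp

/-- The diagonal entries `m_{i,i}` are real and satisfy `m_{i,i} ≥ ε_i² / 32`. -/
theorem statement8 (ε : ℕ → ℝ) (hpos : ∀ j, 1 ≤ j → 0 < ε j)
    (hmono : ∀ j k, 1 ≤ j → j ≤ k → ε k ≤ ε j)
    (hε1 : ε 1 ≤ 2 ^ (-8 : ℤ))
    (δ : ℝ) (hδ1 : ε 1 ≤ δ) (hδ2 : δ ≤ 1 - ε 1)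
    (i : ℕ) (hi : 1 ≤ i) :
    (mEntry ε δ i i).im = 0 ∧ ε i ^ 2 / 32 ≤ (mEntry ε δ i i).re := by
  have hε : 0 < ε i := hpos i hi
  have hεi : ε i ≤ ε 1 := hmono 1 i le_rfl hi
  have hδ : 0 < δ := by linarith
  have hd : 0 < δ ^ i := by positivity
  have hdδ : δ ^ i ≤ δ := pow_le_of_le_one hδ.le (by linarith) (by omega)
  have hr : 0 < ε i * δ ^ i := by positivity
  rw [mEntry_self hr, Complex.ofReal_im, Complex.ofReal_re]
  · refine ⟨rfl, ?_⟩
    generalize δ ^ i = d at *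
    have hd1 : 0 < 1 - d := by linarith
    rw [show (ε i * d) ^ 2 / (1 - (1 - 2 * d) ^ 2) ^ 2 = ε i ^ 2 / (16 * (1 - d) ^ 2) by
      rw [show 1 - (1 - 2 * d) ^ 2 = 4 * d * (1 - d) by ring]
      field_simp
      norm_num]
    gcongr
    nlinarith
  · have hε2 : ε i ≤ 1 := by linarith
    rw [← le_sub_iff_add_le, abs_le]
    constructor <;> nlinarith
end

section
/- Let n ≥ 1, let D be an n × n diagonal complex matrix with positive real diagonal entries d_1, …, d_n, and let N be an n × n complex matrix with operator norm ‖N‖ ≤ 1/2. Set M = D(I + N). Then for every complex n × n matrix R of rank at most n − 1 one has ‖M − R‖ ≥ (1/2)·min_{1≤i≤n} d_i; in other words, the n-th approximation number of M satisfies a_n(M) ≥ a_n(D)/2 = (min_i d_i)/2. -/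
/-- A matrix whose rank is smaller than its size kills a nonzero vector of Euclidean space. -/
theorem exists_ne_zero_toEuclideanCLM_eq_zero {ι : Type*} [Fintype ι] [DecidableEq ι]
    (R : Matrix ι ι ℂ) (hR : R.rank < Fintype.card ι) :
    ∃ v : EuclideanSpace ℂ ι, v ≠ 0 ∧ Matrix.toEuclideanCLM (𝕜 := ℂ) R v = 0 := by
  have hdet : R.det = 0 := by
    by_contra h
    exact hR.ne (R.rank_of_isUnit ((Matrix.isUnit_iff_isUnit_det R).2 (isUnit_iff_ne_zero.2 h)))
  obtain ⟨v, hv, hRv⟩ := Matrix.exists_mulVec_eq_zero_iff.2 hdet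
  refine ⟨WithLp.toLp 2 v, fun h => hv (congrArg WithLp.ofLp h), ?_⟩
  rw [Matrix.toEuclideanCLM_toLp, hRv, WithLp.toLp_zero]

/-- A diagonal matrix with real entries at least `m ≥ 0` expands norms by a factor of
at least `m`. -/
theorem mul_norm_le_norm_toEuclideanCLM_diagonal {ι : Type*} [Fintype ι] [DecidableEq ι]
    (d : ι → ℝ) {m : ℝ} (hm : 0 ≤ m) (hd : ∀ i, m ≤ d i) (x : EuclideanSpace ℂ ι) :
    m * ‖x‖ ≤ ‖Matrix.toEuclideanCLM (𝕜 := ℂ) (Matrix.diagonal fun i => (d i : ℂ)) x‖ := by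
  refine le_of_sq_le_sq ?_ (norm_nonneg _)
  rw [mul_pow, EuclideanSpace.norm_sq_eq, EuclideanSpace.norm_sq_eq, Finset.mul_sum]
  refine Finset.sum_le_sum fun i _ => ?_
  rw [Matrix.ofLp_toEuclideanCLM, Matrix.mulVec_diagonal, norm_mul, mul_pow, Complex.norm_real,
    Real.norm_of_nonneg (hm.trans (hd i))]
  gcongr
  exact hd i


/-- If `D` is a diagonal matrix with positive diagonal entries `d_i`, `‖N‖ ≤ 1/2` and
`M = D(I + N)`, then for every matrix `R` of rank at most `n - 1` one has
`‖M - R‖ ≥ (min_i d_i)/2`; i.e. `a_n(M) ≥ a_n(D)/2 = (min_i d_i)/2`. -/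
theorem statement12 (n : ℕ) (hn : 1 ≤ n) (d : Fin n → ℝ) (hd : ∀ i, 0 < d i)
    (N : Matrix (Fin n) (Fin n) ℂ)
    (hN : ‖Matrix.toEuclideanCLM (𝕜 := ℂ) N‖ ≤ 1 / 2)
    (R : Matrix (Fin n) (Fin n) ℂ) (hR : R.rank ≤ n - 1) :
    (⨅ i, d i) / 2 ≤
      ‖Matrix.toEuclideanCLM (𝕜 := ℂ)
          ((Matrix.diagonal (fun i => (d i : ℂ)) * (1 + N) - R : Matrix (Fin n) (Fin n) ℂ))‖ := by
  have : Nonempty (Fin n) := ⟨⟨0, hn⟩⟩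
  have hm : 0 ≤ ⨅ i, d i := Real.iInf_nonneg fun i => (hd i).le
  obtain ⟨v, hv, hRv⟩ := exists_ne_zero_toEuclideanCLM_eq_zero R (by rw [Fintype.card_fin]; omega)
  have hNv : ‖Matrix.toEuclideanCLM (𝕜 := ℂ) N v‖ ≤ 1 / 2 * ‖v‖ :=
    ContinuousLinearMap.le_of_opNorm_le _ hN v
  have hsub : ‖v‖ - ‖Matrix.toEuclideanCLM (𝕜 := ℂ) N v‖
      ≤ ‖v + Matrix.toEuclideanCLM (𝕜 := ℂ) N v‖ := norm_sub_le_norm_add _ _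
  refine le_of_mul_le_mul_right ?_ (norm_pos_iff.2 hv)
  calc (⨅ i, d i) / 2 * ‖v‖ = (⨅ i, d i) * (1 / 2 * ‖v‖) := by ring
    _ ≤ (⨅ i, d i) * ‖v + Matrix.toEuclideanCLM (𝕜 := ℂ) N v‖ := by
      gcongr
      linarith
    _ ≤ ‖Matrix.toEuclideanCLM (𝕜 := ℂ) (Matrix.diagonal fun i => (d i : ℂ))
          (v + Matrix.toEuclideanCLM (𝕜 := ℂ) N v)‖ :=
      mul_norm_le_norm_toEuclideanCLM_diagonal d hm
        (fun i => ciInf_le (Set.finite_range d).bddBelow i) _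
    _ = ‖Matrix.toEuclideanCLM (𝕜 := ℂ)
          (Matrix.diagonal (fun i => (d i : ℂ)) * (1 + N) - R) v‖ := by
      simp [map_mul, hRv]
    _ ≤ _ := ContinuousLinearMap.le_opNorm _ v
end

section
/- Let H be a complex Hilbert space and T : H → H a bounded linear operator. For every n ≥ 1, the n-th approximation number a_n(T) = inf{‖T − R‖ : R bounded linear of rank < n} equals the n-th Bernstein number b_n(T) = sup over all n-dimensional linear subspaces E of H of inf{‖Tx‖ : x ∈ E, ‖x‖ = 1}. -/
open scoped InnerProductSpace

section

variable {H : Type*} [NormedAddCommGroup H] [InnerProductSpace ℂ H]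

/-- A unit vector of an `n`-dimensional subspace killed by an operator of rank less than `n`. -/
lemma exists_unit_mem_ker_of_rank_lt (R : H →L[ℂ] H) {n : ℕ}
    (hR : LinearMap.rank (R : H →ₗ[ℂ] H) < (n : Cardinal)) (E : Submodule ℂ H)
    (hE : Module.finrank ℂ E = n) : ∃ x ∈ E, ‖x‖ = 1 ∧ R x = 0 := by
  have hn : 0 < n := by
    rcases Nat.eq_zero_or_pos n with rfl | h
    · simp at hR
    · exact h
  have : FiniteDimensional ℂ E := FiniteDimensional.of_finrank_pos (hE ▸ hn)
  have hinj : ¬ Function.Injective ((R : H →ₗ[ℂ] H).domRestrict E) := by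
    intro hi
    have h1 : LinearMap.rank ((R : H →ₗ[ℂ] H).domRestrict E) = Module.rank ℂ E :=
      rank_range_of_injective _ hi
    have h2 : LinearMap.rank ((R : H →ₗ[ℂ] H).domRestrict E) ≤
        LinearMap.rank (R : H →ₗ[ℂ] H) := LinearMap.rank_comp_le_left E.subtype _
    have h3 : Module.rank ℂ E = n := by rw [← hE, Module.finrank_eq_rank]
    rw [h1, h3] at h2
    exact absurd h2 (not_le.mpr hR)
  rw [← LinearMap.ker_eq_bot, Submodule.eq_bot_iff] at hinj
  push Not at hinj
  obtain ⟨x, hx, hx0⟩ := hinj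
  have hxne : (x : H) ≠ 0 := by simpa using hx0
  have hRx : R (x : H) = 0 := by simpa using hx
  refine ⟨((‖(x : H)‖⁻¹ : ℝ) : ℂ) • (x : H), E.smul_mem _ x.2, ?_, ?_⟩
  · rw [norm_smul, Complex.norm_real, norm_inv, norm_norm,
      inv_mul_cancel₀ (norm_ne_zero_iff.mpr hxne)]
  · rw [map_smul, hRx, smul_zero]

lemma sInf_norm_le_norm_sub_of_rank_lt (T R : H →L[ℂ] H) {n : ℕ}
    (hR : LinearMap.rank (R : H →ₗ[ℂ] H) < (n : Cardinal)) (E : Submodule ℂ H)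
    (hE : Module.finrank ℂ E = n) :
    sInf {r : ℝ | ∃ x : H, x ∈ E ∧ ‖x‖ = 1 ∧ r = ‖T x‖} ≤ ‖T - R‖ := by
  obtain ⟨x, hxE, hx1, hRx⟩ := exists_unit_mem_ker_of_rank_lt R hR E hE
  have hbdd : BddBelow {r : ℝ | ∃ x : H, x ∈ E ∧ ‖x‖ = 1 ∧ r = ‖T x‖} :=
    ⟨0, by rintro _ ⟨y, -, -, rfl⟩; exact norm_nonneg _⟩
  refine (csInf_le hbdd ⟨x, hxE, hx1, rfl⟩).trans ?_
  simpa [hRx, hx1] using (T - R).le_opNorm x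

lemma le_sInf_norm_of_finrank_pos (T : H →L[ℂ] H) {c : ℝ} (E : Submodule ℂ H)
    (hE : 0 < Module.finrank ℂ E) (hc : ∀ x ∈ E, c * ‖x‖ ≤ ‖T x‖) :
    c ≤ sInf {r : ℝ | ∃ x : H, x ∈ E ∧ ‖x‖ = 1 ∧ r = ‖T x‖} := by
  have : Nontrivial E := Module.nontrivial_of_finrank_pos hE
  obtain ⟨x, hx⟩ := exists_norm_eq E (zero_le_one (α := ℝ))
  refine le_csInf ⟨_, x, x.2, hx, rfl⟩ ?_
  rintro _ ⟨y, hy, hy1, rfl⟩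
  simpa [hy1] using hc y hy

lemma Submodule.exists_le_finrank_eq_of_le_rank (M : Submodule ℂ H) {n : ℕ}
    (h : (n : Cardinal) ≤ Module.rank ℂ M) : ∃ E ≤ M, Module.finrank ℂ E = n := by
  obtain ⟨s, hs, hli⟩ := le_rank_iff_exists_linearIndependent_finset.mp h
  refine ⟨(Submodule.span ℂ (s : Set M)).map M.subtype, Submodule.map_subtype_le _ _, ?_⟩
  rw [Submodule.finrank_map_subtype_eq]
  exact (finrank_span_finset_eq_card hli).trans hs

/-- A spectral cutoff at level `c`: `T` is bounded below by `c` on the range of `F`, and by `c`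
from above after `1 - F`. -/
lemma exists_spectral_cutoff [CompleteSpace H] (T : H →L[ℂ] H) {c : ℝ} (hc : 0 < c) :
    ∃ F : H →L[ℂ] H, (∀ x, c * ‖F x‖ ≤ ‖T (F x)‖) ∧ ∀ x, ‖T (x - F x)‖ ≤ c * ‖x‖ := by
  set A : H →L[ℂ] H := star T * T with hA
  have hAsa : IsSelfAdjoint A := IsSelfAdjoint.star_mul_self T
  have hmax : ∀ t : ℝ, 0 < max t (c ^ 2) := fun t => lt_max_of_lt_right (by positivity)
  set f : ℝ → ℝ := fun t => 1 - c ^ 2 / max t (c ^ 2) with hf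
  have hfc : Continuous f :=
    continuous_const.sub (continuous_const.div (by fun_prop) fun t => (hmax t).ne')
  set F : H →L[ℂ] H := cfc f A with hF
  have hFsa : IsSelfAdjoint F := cfc_predicate f A
  have hsq : ∀ y, ‖T y‖ ^ 2 = (⟪A y, y⟫_ℂ).re := fun y => by
    rw [hA, mul_apply_eq_comp, ContinuousLinearMap.star_eq_adjoint]
    exact T.apply_norm_sq_eq_inner_adjoint_left y
  have hlow : 0 ≤ F * (A - algebraMap ℝ (H →L[ℂ] H) (c ^ 2)) * F := by
    have h : cfc (fun t => f t * (t - c ^ 2) * f t) A =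
        F * (A - algebraMap ℝ (H →L[ℂ] H) (c ^ 2)) * F := by
      rw [cfc_mul (fun t => f t * (t - c ^ 2)) f A (by fun_prop) (by fun_prop),
        cfc_mul f (fun t => t - c ^ 2) A (by fun_prop) (by fun_prop),
        cfc_sub (fun t : ℝ => t) (fun _ => c ^ 2) A (by fun_prop) (by fun_prop),
        cfc_id' ℝ A, cfc_const (c ^ 2) A]
    rw [← h]
    refine cfc_nonneg fun t _ => ?_
    rcases le_total t (c ^ 2) with ht | ht
    · have : f t = 0 := by simp [hf, max_eq_right ht, hc.ne']
      simp [this]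
    · nlinarith [mul_nonneg (sub_nonneg.mpr ht) (mul_self_nonneg (f t))]
  have hup : 0 ≤ algebraMap ℝ (H →L[ℂ] H) (c ^ 2) - (1 - F) * A * (1 - F) := by
    have h : cfc (fun t => c ^ 2 - (1 - f t) * t * (1 - f t)) A =
        algebraMap ℝ (H →L[ℂ] H) (c ^ 2) - (1 - F) * A * (1 - F) := by
      rw [cfc_sub (fun _ => c ^ 2) (fun t => (1 - f t) * t * (1 - f t)) A
          (by fun_prop) (by fun_prop),
        cfc_mul (fun t => (1 - f t) * t) (fun t => 1 - f t) A (by fun_prop) (by fun_prop),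
        cfc_mul (fun t => 1 - f t) (fun t => t) A (by fun_prop) (by fun_prop),
        cfc_sub (fun _ => 1) f A (by fun_prop) (by fun_prop),
        cfc_id' ℝ A, cfc_const (c ^ 2) A, cfc_const_one ℝ A]
    rw [← h]
    refine cfc_nonneg fun t _ => ?_
    rcases le_total t (c ^ 2) with ht | ht
    · have : f t = 0 := by simp [hf, max_eq_right ht, hc.ne']
      simpa [this] using ht
    · have ht0 : 0 < t := lt_of_lt_of_le (by positivity) ht
      have h1 : 1 - f t = c ^ 2 / t := by simp [hf, max_eq_left ht]
      have h2 : c ^ 2 / t * t * (c ^ 2 / t) = c ^ 2 * (c ^ 2 / t) := by field_simp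
      have h3 : c ^ 2 / t ≤ 1 := (div_le_one ht0).mpr ht
      rw [h1, h2]
      nlinarith [sq_nonneg c]
  have hmove : ∀ {G : H →L[ℂ] H}, IsSelfAdjoint G → ∀ y z, ⟪G y, z⟫_ℂ = ⟪y, G z⟫_ℂ :=
    fun hG y z => hG.isSymmetric y z
  have hreal : ∀ y : H, (⟪algebraMap ℝ (H →L[ℂ] H) (c ^ 2) y, y⟫_ℂ).re = c ^ 2 * ‖y‖ ^ 2 := by
    intro y
    rw [Algebra.algebraMap_eq_smul_one, smul_apply,
      one_apply_eq_self, ← Complex.coe_smul, inner_smul_left, Complex.conj_ofReal,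
      Complex.re_ofReal_mul]
    congr 1
    exact inner_self_eq_norm_sq (𝕜 := ℂ) y
  rw [ContinuousLinearMap.nonneg_iff_isPositive] at hlow hup
  refine ⟨F, fun x => ?_, fun x => ?_⟩
  · have h := hlow.re_inner_nonneg_left x
    rw [mul_apply_eq_comp, mul_apply_eq_comp, hmove hFsa,
      sub_apply, inner_sub_left, map_sub] at h
    simp only [RCLike.re_to_complex] at h
    rw [hreal, ← hsq] at h
    refine le_of_sq_le_sq ?_ (norm_nonneg _)
    rw [mul_pow]
    linarith
  · have h := hup.re_inner_nonneg_left x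
    rw [sub_apply, inner_sub_left, map_sub,
      mul_apply_eq_comp, mul_apply_eq_comp,
      hmove ((IsSelfAdjoint.one _).sub hFsa)] at h
    simp only [RCLike.re_to_complex] at h
    rw [hreal, ← hsq] at h
    refine le_of_sq_le_sq ?_ (by positivity)
    rw [mul_pow]
    simpa using h

end

/-- On a complex Hilbert space, the `n`-th approximation number
`a_n(T) = inf {‖T - R‖ : rank R < n}` of a bounded operator `T` equals the `n`-th
Bernstein number `b_n(T) = sup_{dim E = n} inf {‖Tx‖ : x ∈ E, ‖x‖ = 1}`. -/
theorem statement13 {H : Type*} [NormedAddCommGroup H] [InnerProductSpace ℂ H]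
    [CompleteSpace H] (T : H →L[ℂ] H) (n : ℕ) (hn : 1 ≤ n) :
    sInf {c : ℝ | ∃ R : H →L[ℂ] H,
        LinearMap.rank (R : H →ₗ[ℂ] H) < (n : Cardinal) ∧ c = ‖T - R‖} =
    sSup {c : ℝ | ∃ E : Submodule ℂ H, Module.finrank ℂ E = n ∧
        c = sInf {r : ℝ | ∃ x : H, x ∈ E ∧ ‖x‖ = 1 ∧ r = ‖T x‖}} := by
  have hzero : LinearMap.rank ((0 : H →L[ℂ] H) : H →ₗ[ℂ] H) < (n : Cardinal) := by
    rw [ContinuousLinearMap.toLinearMap_zero, LinearMap.rank_zero]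
    exact_mod_cast hn
  have hnonneg : 0 ≤ sSup {c : ℝ | ∃ E : Submodule ℂ H, Module.finrank ℂ E = n ∧
      c = sInf {r : ℝ | ∃ x : H, x ∈ E ∧ ‖x‖ = 1 ∧ r = ‖T x‖}} := by
    refine Real.sSup_nonneg ?_
    rintro _ ⟨E, -, rfl⟩
    refine Real.sInf_nonneg ?_
    rintro _ ⟨x, -, -, rfl⟩
    exact norm_nonneg _
  apply le_antisymm
  · refine le_of_forall_lt_imp_le_of_dense fun c hc => ?_
    rcases le_or_gt c 0 with hc0 | hc0
    · exact hc0.trans hnonneg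
    obtain ⟨F, hlow, hup⟩ := exists_spectral_cutoff T hc0
    have hrank : (n : Cardinal) ≤ LinearMap.rank (F : H →ₗ[ℂ] H) := by
      by_contra! hlt
      have hTF : LinearMap.rank ((T ∘L F : H →L[ℂ] H) : H →ₗ[ℂ] H) < (n : Cardinal) :=
        (LinearMap.rank_comp_le_right (F : H →ₗ[ℂ] H) (T : H →ₗ[ℂ] H)).trans_lt hlt
      have hle : ‖T - T ∘L F‖ ≤ c :=
        ContinuousLinearMap.opNorm_le_bound _ hc0.le fun x => by simpa using hup x
      refine (hc.trans_le (csInf_le ⟨0, ?_⟩ ⟨_, hTF, rfl⟩)).not_ge hle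
      rintro _ ⟨R, -, rfl⟩
      exact norm_nonneg _
    obtain ⟨E, hEF, hE⟩ := Submodule.exists_le_finrank_eq_of_le_rank _ hrank
    refine (le_sInf_norm_of_finrank_pos T E (by omega) fun x hx => ?_).trans
      (le_csSup ⟨‖T - 0‖, ?_⟩ ⟨E, hE, rfl⟩)
    · obtain ⟨y, rfl⟩ := hEF hx
      exact hlow y
    · rintro _ ⟨E, hE, rfl⟩
      exact sInf_norm_le_norm_sub_of_rank_lt T 0 hzero E hE
  · refine le_csInf ⟨_, 0, hzero, rfl⟩ ?_
    rintro _ ⟨R, hR, rfl⟩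
    refine Real.sSup_le ?_ (norm_nonneg _)
    rintro _ ⟨E, hE, rfl⟩
    exact sInf_norm_le_norm_sub_of_rank_lt T R hR E hE
end

section
/- Let φ : 𝔻 → 𝔻 be a nonconstant analytic map with ∫_𝔻 |φ′(z)|² dA(z) < ∞. Then there exist constants c > 0 and δ ∈ (0,1) such that for every integer p ≥ 1, the Dirichlet energy of φ^p satisfies p² ∫_𝔻 |φ(z)|^{2p−2}|φ′(z)|² dA(z) ≥ c·δ^p. In particular ‖φ^p‖_𝒟² cannot tend to 0 faster than geometrically, so in Theorem OPT the hypothesis lim M_p = ∞ cannot be replaced by limsup M_p = ∞. -/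
open MeasureTheory
open scoped ENNReal

/-- A nonconstant holomorphic function on a disk has a point where neither it nor its derivative
vanishes. -/
theorem exists_ne_zero_deriv_ne_zero {φ : ℂ → ℂ}
    (hφ : DifferentiableOn ℂ φ (Metric.ball 0 1))
    (hnc : ¬ ∀ z ∈ Metric.ball (0 : ℂ) 1, φ z = φ 0) :
    ∃ z ∈ Metric.ball (0 : ℂ) 1, φ z ≠ 0 ∧ deriv φ z ≠ 0 := by
  by_contra! h
  have h0 : (0 : ℂ) ∈ Metric.ball (0 : ℂ) 1 := by simp
  have hc : IsPreconnected (Metric.ball (0 : ℂ) 1) := (convex_ball 0 1).isPreconnected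
  have hsq : ∀ z ∈ Metric.ball (0 : ℂ) 1, φ z ^ 2 = φ 0 ^ 2 := by
    intro z hz
    refine Metric.isOpen_ball.is_const_of_deriv_eq_zero (f := fun z => φ z ^ 2) hc
      (hφ.pow 2) (fun w hw => ?_) hz h0
    have hd := ((hφ.differentiableAt (Metric.isOpen_ball.mem_nhds hw)).hasDerivAt.pow 2).deriv
    simp only [Pi.pow_def] at hd
    rw [hd]
    by_cases hw0 : φ w = 0
    · simp [hw0]
    · simp [h w hw hw0]
  by_cases h00 : φ 0 = 0
  · exact hnc fun z hz => by simpa [h00] using hsq z hz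
  · refine hnc fun z hz => Metric.isOpen_ball.is_const_of_deriv_eq_zero hc hφ
      (fun w hw => h w hw fun hw0 => h00 ?_) hz h0
    simpa [hw0] using (hsq w hw).symm

/-- If `φ` is a nonconstant analytic self-map of the disk with finite Dirichlet integral,
then there are `c > 0` and `δ ∈ (0,1)` with
`p² ∫ |φ|^{2p-2} |φ′|² dA ≥ c δ^p` for all `p ≥ 1`. -/
theorem statement18 (φ : ℂ → ℂ) (hφ : DifferentiableOn ℂ φ (Metric.ball 0 1))
    (hmap : Set.MapsTo φ (Metric.ball 0 1) (Metric.ball 0 1))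
    (hnc : ¬ ∀ z ∈ Metric.ball (0 : ℂ) 1, φ z = φ 0)
    (hfin : (∫⁻ z in Metric.ball (0 : ℂ) 1,
        ENNReal.ofReal (‖deriv φ z‖ ^ 2) ∂areaA) < ⊤) :
    ∃ c : ℝ, 0 < c ∧ ∃ δ : ℝ, 0 < δ ∧ δ < 1 ∧ ∀ p : ℕ, 1 ≤ p →
      ENNReal.ofReal (c * δ ^ p) ≤
        (p : ℝ≥0∞) ^ 2 *
          ∫⁻ z in Metric.ball (0 : ℂ) 1,
            ENNReal.ofReal (‖φ z‖ ^ (2 * p - 2) * ‖deriv φ z‖ ^ 2) ∂areaA := by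
  obtain ⟨z₀, hz₀, hφ0, hd0⟩ := exists_ne_zero_deriv_ne_zero hφ hnc
  have hmem := Metric.isOpen_ball.mem_nhds hz₀
  have hcont : ContinuousAt φ z₀ := (hφ.differentiableAt hmem).continuousAt
  have hcont' : ContinuousAt (deriv φ) z₀ :=
    ((hφ.deriv Metric.isOpen_ball).differentiableAt hmem).continuousAt
  set a := ‖φ z₀‖ / 2 with ha
  set b := ‖deriv φ z₀‖ / 2 with hb
  have ha0 : 0 < ‖φ z₀‖ := norm_pos_iff.2 hφ0
  have hb0 : 0 < ‖deriv φ z₀‖ := norm_pos_iff.2 hd0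
  have ha1 : ‖φ z₀‖ < 1 := by simpa using hmap hz₀
  have hapos : 0 < a := by positivity
  have hbpos : 0 < b := by positivity
  have halt : a < 1 := by linarith
  have hev : ∀ᶠ z in nhds z₀, a < ‖φ z‖ ∧ b < ‖deriv φ z‖ ∧ z ∈ Metric.ball (0 : ℂ) 1 :=
    (hcont.norm.eventually_const_lt (by linarith)).and
      ((hcont'.norm.eventually_const_lt (by linarith)).and hmem)
  obtain ⟨r, hr, hball⟩ := Metric.eventually_nhds_iff_ball.1 hev
  set m := areaA (Metric.ball z₀ r) with hm
  have hπ : ENNReal.ofReal (1 / Real.pi) ≠ 0 := by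
    simpa using Real.pi_pos
  have hm0 : m ≠ 0 := by
    simp only [hm, areaA, Measure.smul_apply, smul_eq_mul]
    exact mul_ne_zero hπ (Metric.measure_ball_pos volume z₀ hr).ne'
  have hmt : m ≠ ⊤ := by
    simp only [hm, areaA, Measure.smul_apply, smul_eq_mul]
    exact ENNReal.mul_ne_top ENNReal.ofReal_ne_top measure_ball_lt_top.ne
  refine ⟨b ^ 2 * m.toReal, mul_pos (by positivity) (ENNReal.toReal_pos hm0 hmt), a ^ 2,
    by positivity, by nlinarith, fun p hp => ?_⟩
  calc ENNReal.ofReal (b ^ 2 * m.toReal * (a ^ 2) ^ p)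
      ≤ ENNReal.ofReal (a ^ (2 * p - 2) * b ^ 2 * m.toReal) := by
        apply ENNReal.ofReal_le_ofReal
        rw [← pow_mul, mul_comm, ← mul_assoc]
        gcongr ?_ * _ * _
        exact pow_le_pow_of_le_one hapos.le halt.le (by omega)
    _ = ∫⁻ _ in Metric.ball z₀ r, ENNReal.ofReal (a ^ (2 * p - 2) * b ^ 2) ∂areaA := by
        rw [setLIntegral_const, ENNReal.ofReal_mul (by positivity), ENNReal.ofReal_toReal hmt]
    _ ≤ ∫⁻ z in Metric.ball z₀ r,
          ENNReal.ofReal (‖φ z‖ ^ (2 * p - 2) * ‖deriv φ z‖ ^ 2) ∂areaA := by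
        refine setLIntegral_mono' measurableSet_ball fun z hz => ENNReal.ofReal_le_ofReal ?_
        obtain ⟨h1, h2, -⟩ := hball z hz
        gcongr
    _ ≤ ∫⁻ z in Metric.ball (0 : ℂ) 1,
          ENNReal.ofReal (‖φ z‖ ^ (2 * p - 2) * ‖deriv φ z‖ ^ 2) ∂areaA :=
        lintegral_mono_set fun z hz => (hball z hz).2.2
    _ ≤ _ := le_mul_of_one_le_left' (one_le_pow₀ (by exact_mod_cast hp))
end
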